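/- arXiv:1703.08638 — 3 statements merged into one kernel-verified Lean document; each statement's English description precedes it below -/
import Mathlib

section
/- (Recursive shrinking bounds, first-order version.) Let a > 0, c > 0 and σ ≤ μ < 0. Set N = max{N₀, φ(0)} and τ = a + c·N, and suppose φ is continuous with φ(t) ≥ M₀ for all t ∈ [−τ, 0]. Let u be a solution of the SDDE. Let (Mₙ)ₙ≥0 and (Nₙ)ₙ≥0 be real sequences with M_0 = M₀, N_0 = N₀, and for every n: M_{n+1} ∈ [M₀, 0] with Q₁(M_{n+1}, Nₙ) = 0, and N_{n+1} ∈ [0, N₀] with Q₁(N_{n+1}, Mₙ) = 0. Then for every n there exists Tₙ ≥ 0 such that u(t) ∈ [Mₙ, Nₙ] for all t ≥ Tₙ. -/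
open Real Set Filter

/-- `M₀ = -a/c`. -/
noncomputable def Mzero (a c : ℝ) : ℝ := -a / c

/-- `N₀ = aσ/(cμ)`. -/
noncomputable def Nzero (a c μ σ : ℝ) : ℝ := a * σ / (c * μ)

/-- A solution of the SDDE `u'(t) = μ u(t) + σ u(t - a - c u(t))` with history `φ`:
a continuous function equal to `φ` on `(-∞,0]`, differentiable on `(0,∞)` with
continuous derivative there, satisfying the SDDE for all `t > 0`. -/
def IsSDDESolution (a c μ σ : ℝ) (φ u : ℝ → ℝ) : Prop :=
  Continuous u ∧ (∀ t ≤ (0:ℝ), u t = φ t) ∧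
  ContinuousOn (deriv u) (Set.Ioi (0:ℝ)) ∧
  ∀ t > (0:ℝ), HasDerivAt u (μ * u t + σ * u (t - a - c * u t)) t

/-- `Q₁(v,x) = (1 + (μ/σ) e^{μ(a+cv)}) v + (σ/μ) x (1 - e^{μ(a+cv)})`. -/
noncomputable def Qone (a c μ σ v x : ℝ) : ℝ :=
  (1 + (μ / σ) * Real.exp (μ * (a + c * v))) * v +
    (σ / μ) * x * (1 - Real.exp (μ * (a + c * v)))

section Auxiliary

variable {a c μ σ N v w x : ℝ} {u : ℝ → ℝ}

/-- The last time a continuous function is at or below a level before exceeding it. -/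
lemma exists_last_le {f : ℝ → ℝ} (hf : Continuous f) {K t₀ t₁ : ℝ} (h : t₀ ≤ t₁)
    (h₀ : f t₀ ≤ K) (h₁ : K < f t₁) :
    ∃ s, t₀ ≤ s ∧ s < t₁ ∧ f s = K ∧ ∀ t, s < t → t ≤ t₁ → K < f t := by
  have hcomp : IsCompact (Icc t₀ t₁ ∩ {t | f t ≤ K}) :=
    isCompact_Icc.inter_right (isClosed_le hf continuous_const)
  obtain ⟨s, ⟨⟨hs₀, hs₁⟩, hsK⟩, hmax⟩ := hcomp.exists_isGreatest ⟨t₀, ⟨le_rfl, h⟩, h₀⟩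
  have hsK : f s ≤ K := hsK
  have hlt : s < t₁ := lt_of_le_of_ne hs₁ (by rintro rfl; linarith)
  have habove : ∀ t, s < t → t ≤ t₁ → K < f t := by
    intro t hst ht
    by_contra! hle
    exact absurd (hmax ⟨⟨hs₀.trans hst.le, ht⟩, hle⟩) (not_le.2 hst)
  refine ⟨s, hs₀, hlt, le_antisymm hsK ?_, habove⟩
  refine ge_of_tendsto (hf.continuousAt.tendsto.mono_left nhdsWithin_le_nhds :
    Tendsto f (nhdsWithin s (Ioi s)) _) ?_
  filter_upwards [Ioc_mem_nhdsGT hlt] with t ht using (habove t ht.1 ht.2).le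

/-- One-sided variation of constants for `f' ≤ μ f + b`. -/
lemma add_div_le_exp_mul_of_deriv_le {f f' : ℝ → ℝ} {b t₀ t₁ : ℝ} (hμ : μ ≠ 0) (h : t₀ ≤ t₁)
    (hf : Continuous f) (hd : ∀ t ∈ Ioo t₀ t₁, HasDerivAt f (f' t) t)
    (hle : ∀ t ∈ Ioo t₀ t₁, f' t ≤ μ * f t + b) :
    f t₁ + b / μ ≤ exp (μ * (t₁ - t₀)) * (f t₀ + b / μ) := by
  have hanti : AntitoneOn (fun t => exp (-μ * t) * (f t + b / μ)) (Icc t₀ t₁) := by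
    refine antitoneOn_of_hasDerivWithinAt_nonpos (convex_Icc _ _)
      (f' := fun t => exp (-μ * t) * (f' t - (μ * f t + b))) (by fun_prop) ?_ ?_
    · intro t ht
      rw [interior_Icc] at ht
      have he : HasDerivAt (fun t : ℝ => exp (-μ * t)) (exp (-μ * t) * (-μ)) t := by
        simpa using ((hasDerivAt_id t).const_mul (-μ)).exp
      refine ((he.mul ((hd t ht).add_const (b / μ))).congr_deriv ?_).hasDerivWithinAt
      field_simp
      ring
    · intro t ht
      rw [interior_Icc] at ht
      exact mul_nonpos_of_nonneg_of_nonpos (exp_pos _).le (by linarith [hle t ht])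
  have key := hanti ⟨le_rfl, h⟩ ⟨h, le_rfl⟩ h
  have hmul := mul_le_mul_of_nonneg_left key (exp_pos (μ * t₁)).le
  simp only [← mul_assoc, ← exp_add] at hmul
  rw [show μ * t₁ + -μ * t₁ = 0 by ring, exp_zero, one_mul,
    show μ * t₁ + -μ * t₀ = μ * (t₁ - t₀) by ring] at hmul
  exact hmul

lemma strictMonoOn_mul_one_add_exp_div (ha : 0 < a) (hc : 0 < c) (hμ : μ < 0) :
    StrictMonoOn (fun v => v * (1 + exp (μ * (a + c * v))) / (1 - exp (μ * (a + c * v))))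
      (Ioi (-a / c)) := by
  have hpos : ∀ v ∈ Ioi (-a / c), 0 < a + c * v := by
    intro v hv
    have := (div_lt_iff₀ hc).1 (mem_Ioi.1 hv)
    linarith
  have hE : ∀ v ∈ Ioi (-a / c), exp (μ * (a + c * v)) < 1 := fun v hv =>
    exp_lt_one_iff.2 (mul_neg_of_neg_of_pos hμ (hpos v hv))
  have hd : ∀ v ∈ Ioi (-a / c), HasDerivAt
      (fun v => v * (1 + exp (μ * (a + c * v))) / (1 - exp (μ * (a + c * v))))
      ((1 - exp (μ * (a + c * v)) ^ 2 + 2 * v * (μ * c) * exp (μ * (a + c * v))) /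
        (1 - exp (μ * (a + c * v))) ^ 2) v := by
    intro v hv
    have he : HasDerivAt (fun v : ℝ => exp (μ * (a + c * v)))
        (exp (μ * (a + c * v)) * (μ * c)) v := by
      simpa using ((((hasDerivAt_id v).const_mul c).const_add a).const_mul μ).exp
    have hne : 1 - exp (μ * (a + c * v)) ≠ 0 := by linarith [hE v hv]
    refine (((hasDerivAt_id v).mul (he.const_add 1)).div (he.const_sub 1) hne).congr_deriv ?_
    simp only [id, Pi.mul_apply]
    ring
  refine strictMonoOn_of_hasDerivWithinAt_pos (convex_Ioi _)
    (fun v hv => (hd v hv).continuousAt.continuousWithinAt)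
    (fun v hv => (hd v (interior_subset hv)).hasDerivWithinAt) ?_
  intro v hv
  have hv := interior_subset hv
  have hne : 0 < 1 - exp (μ * (a + c * v)) := by linarith [hE v hv]
  refine div_pos ?_ (by positivity)
  have hy : 0 < -(μ * (a + c * v)) := by nlinarith [hpos v hv]
  have hs := self_lt_sinh_iff.2 hy
  rw [sinh_eq, neg_neg] at hs
  have hEpos := exp_pos (μ * (a + c * v))
  have hmul : exp (-(μ * (a + c * v))) * exp (μ * (a + c * v)) = 1 := by
    rw [← exp_add]; simp
  have haμ : 0 < (-μ * a) * exp (μ * (a + c * v)) := by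
    have : 0 < -μ * a := by nlinarith
    positivity
  nlinarith [mul_lt_mul_of_pos_right hs hEpos]

lemma strictMonoOn_mul_one_add_mul_exp_div (ha : 0 < a) (hc : 0 < c) (hσμ : σ ≤ μ) (hμ : μ < 0) :
    StrictMonoOn
      (fun v => v * (1 + μ / σ * exp (μ * (a + c * v))) / (1 - exp (μ * (a + c * v))))
      (Ioi (-a / c)) := by
  have hσ : σ < 0 := hσμ.trans_lt hμ
  have hk : 0 < μ / σ := div_pos_of_neg_of_neg hμ hσ
  have hk1 : μ / σ ≤ 1 := (div_le_one_of_neg hσ).2 hσμ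
  have key : ∀ v ∈ Ioi (-a / c),
      v * (1 + μ / σ * exp (μ * (a + c * v))) / (1 - exp (μ * (a + c * v))) =
      (1 - μ / σ) / 2 * v + (1 + μ / σ) / 2 *
        (v * (1 + exp (μ * (a + c * v))) / (1 - exp (μ * (a + c * v)))) := by
    intro v hv
    have hp : 0 < a + c * v := by
      have := (div_lt_iff₀ hc).1 (mem_Ioi.1 hv)
      linarith
    have hne : 1 - exp (μ * (a + c * v)) ≠ 0 := by
      have := exp_lt_one_iff.2 (mul_neg_of_neg_of_pos hμ hp)
      linarith
    generalize exp (μ * (a + c * v)) = E at hne ⊢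
    generalize μ / σ = k
    field_simp
    ring
  intro v hv w hw hvw
  simp only [key v hv, key w hw]
  have h := strictMonoOn_mul_one_add_exp_div ha hc hμ hv hw hvw
  refine add_lt_add_of_le_of_lt ?_ ?_
  · exact mul_le_mul_of_nonneg_left hvw.le (by linarith)
  · exact mul_lt_mul_of_pos_left h (by linarith)

lemma Qone_Mzero_neg (ha : 0 < a) (hc : 0 < c) (hσμ : σ ≤ μ) (hμ : μ < 0) :
    Qone a c μ σ (Mzero a c) x < 0 := by
  have hk : 0 < μ / σ := div_pos_of_neg_of_neg hμ (hσμ.trans_lt hμ)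
  have hM : a + c * Mzero a c = 0 := by unfold Mzero; field_simp; ring
  have hneg : Mzero a c < 0 := div_neg_of_neg_of_pos (by linarith) hc
  unfold Qone
  rw [hM]
  simp only [mul_zero, exp_zero, mul_one, sub_self, add_zero]
  nlinarith

/-- `Q₁(·, x)` is positive to the right of any point where it is nonnegative. -/
lemma Qone_pos_of_nonneg_of_lt (ha : 0 < a) (hc : 0 < c) (hσμ : σ ≤ μ) (hμ : μ < 0)
    (hv : Mzero a c ≤ v) (hQ : 0 ≤ Qone a c μ σ v x) (hvw : v < w) :
    0 < Qone a c μ σ w x := by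
  have hv' : Mzero a c < v := by
    refine lt_of_le_of_ne hv ?_
    rintro rfl
    exact absurd hQ (not_le.2 (Qone_Mzero_neg ha hc hσμ hμ))
  have hE : ∀ v, Mzero a c < v → 0 < 1 - exp (μ * (a + c * v)) := by
    intro v hv
    have hp := (div_lt_iff₀ hc).1 hv
    have := exp_lt_one_iff.2 (mul_neg_of_neg_of_pos hμ (show 0 < a + c * v by linarith))
    linarith
  have hfac : ∀ v, Mzero a c < v → Qone a c μ σ v x = (1 - exp (μ * (a + c * v))) *
      (v * (1 + μ / σ * exp (μ * (a + c * v))) / (1 - exp (μ * (a + c * v))) + σ / μ * x) := by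
    intro v hv
    rw [mul_add, mul_div_cancel₀ _ (hE v hv).ne']
    unfold Qone
    ring
  have hw' := hv'.trans hvw
  have hlt := strictMonoOn_mul_one_add_mul_exp_div ha hc hσμ hμ hv' hw' hvw
  rw [hfac v hv'] at hQ
  rw [hfac w hw']
  have h0 := nonneg_of_mul_nonneg_right hQ (hE v hv')
  simp only at hlt
  exact mul_pos (hE w hw') (by linarith)

/-- The right-hand side of the equation, as a function of time. -/
noncomputable def sddeRHS (a c μ σ : ℝ) (u : ℝ → ℝ) (t : ℝ) : ℝ :=
  μ * u t + σ * u (t - a - c * u t)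

lemma continuous_sddeRHS (hu : Continuous u) : Continuous (sddeRHS a c μ σ u) := by
  unfold sddeRHS
  fun_prop

lemma exists_sub_eq_sddeRHS_mul (hu : Continuous u)
    (hd : ∀ t > 0, HasDerivAt u (sddeRHS a c μ σ u t) t) {s t : ℝ} (hs : 0 ≤ s) (hst : s < t) :
    ∃ r ∈ Ioo s t, u t - u s = sddeRHS a c μ σ u r * (t - s) := by
  obtain ⟨r, hr, h⟩ := exists_hasDerivAt_eq_slope u (sddeRHS a c μ σ u) hst hu.continuousOn
    (fun r hr => hd r (hs.trans_lt hr.1))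
  exact ⟨r, hr, by rw [h, div_mul_cancel₀ _ (sub_pos.2 hst).ne']⟩

lemma Mzero_le_of_solution (ha : 0 < a) (hc : 0 < c) (hσμ : σ ≤ μ) (hμ : μ < 0)
    (hu : Continuous u) (hd : ∀ t > 0, HasDerivAt u (sddeRHS a c μ σ u t) t)
    (h0 : Mzero a c ≤ u 0) {t : ℝ} (ht : 0 ≤ t) : Mzero a c ≤ u t := by
  by_contra! hlt
  obtain ⟨s, hs, hst, hus, hbelow⟩ := exists_last_le hu.neg ht (neg_le_neg h0) (neg_lt_neg hlt)
  have hus : u s = Mzero a c := neg_injective hus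
  have hM : a + c * Mzero a c = 0 := by unfold Mzero; field_simp; ring
  have hneg : Mzero a c < 0 := div_neg_of_neg_of_pos (by linarith) hc
  have hF : 0 < sddeRHS a c μ σ u s := by
    unfold sddeRHS
    rw [hus, show s - a - c * Mzero a c = s by linarith, hus]
    nlinarith
  have hev := (continuous_sddeRHS (a := a) (c := c) (μ := μ) (σ := σ) hu).continuousAt.eventually
    (lt_mem_nhds hF)
  obtain ⟨δ, hδ, hball⟩ := Metric.eventually_nhds_iff.1 hev
  have hsb : s < min t (s + δ / 2) := lt_min hst (by linarith)
  obtain ⟨r, hr, heq⟩ := exists_sub_eq_sddeRHS_mul hu hd hs hsb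
  have hrδ : r < s + δ / 2 := hr.2.trans_le (min_le_right _ _)
  have hFr : 0 < sddeRHS a c μ σ u r :=
    hball (by rw [Real.dist_eq, abs_of_pos] <;> linarith [hr.1])
  have hpos := mul_pos hFr (sub_pos.2 hsb)
  have := hbelow _ hsb (min_le_left _ _)
  simp only [Pi.neg_apply] at this
  linarith

lemma mul_Nzero_eq (hc : 0 < c) (hμ : μ < 0) : μ * Nzero a c μ σ = -(σ * Mzero a c) := by
  have := hμ.ne
  unfold Nzero Mzero
  field_simp

lemma Nzero_pos (ha : 0 < a) (hc : 0 < c) (hσμ : σ ≤ μ) (hμ : μ < 0) : 0 < Nzero a c μ σ :=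
  div_pos_of_neg_of_neg (mul_neg_of_pos_of_neg ha (hσμ.trans_lt hμ)) (mul_neg_of_pos_of_neg hc hμ)

/-- Above `N₀` the solution decreases, provided the delayed time is in the controlled range. -/
lemma sddeRHS_neg_of_Nzero_lt (hc : 0 < c) (hσμ : σ ≤ μ) (hμ : μ < 0) {τ t : ℝ}
    (hlow : ∀ t ≥ -τ, Mzero a c ≤ u t) (ht : -τ ≤ t - a - c * u t)
    (hut : Nzero a c μ σ < u t) : sddeRHS a c μ σ u t < 0 := by
  have h1 := hlow _ ht
  have h2 := mul_Nzero_eq (a := a) (σ := σ) hc hμ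
  unfold sddeRHS
  nlinarith [mul_le_mul_of_nonpos_left h1 (hσμ.trans hμ.le), mul_lt_mul_of_neg_left hut hμ]

lemma le_of_solution (hc : 0 < c) (hσμ : σ ≤ μ) (hμ : μ < 0)
    (hu : Continuous u) (hd : ∀ t > 0, HasDerivAt u (sddeRHS a c μ σ u t) t)
    (hN : Nzero a c μ σ ≤ N) (hlow : ∀ t ≥ -(a + c * N), Mzero a c ≤ u t)
    (h0 : u 0 ≤ N) {t : ℝ} (ht : 0 ≤ t) : u t ≤ N := by
  by_contra! hlt
  obtain ⟨s, hs, hst, hus, habove⟩ := exists_last_le hu ht h0 hlt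
  have hF : sddeRHS a c μ σ u s < 1 / c := by
    have h1 := hlow (s - a - c * u s) (by rw [hus]; linarith)
    have h2 := mul_Nzero_eq (a := a) (σ := σ) hc hμ
    have h3 : 0 < 1 / c := by positivity
    unfold sddeRHS
    nlinarith [mul_le_mul_of_nonpos_left h1 (hσμ.trans hμ.le),
      mul_le_mul_of_nonpos_left hN hμ.le]
  have hev := (continuous_sddeRHS (a := a) (c := c) (μ := μ) (σ := σ) hu).continuousAt.eventually
    (gt_mem_nhds hF)
  obtain ⟨δ, hδ, hball⟩ := Metric.eventually_nhds_iff.1 hev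
  have hsb : s < min t (s + δ / 2) := lt_min hst (by linarith)
  have hdelay : ∀ r ∈ Ioo s (min t (s + δ / 2)), -(a + c * N) ≤ r - a - c * u r := by
    intro r hr
    obtain ⟨q, hq, heq⟩ := exists_sub_eq_sddeRHS_mul hu hd hs hr.1
    have hrδ : r < s + δ / 2 := hr.2.trans_le (min_le_right _ _)
    have hFq : sddeRHS a c μ σ u q < 1 / c :=
      hball (by rw [Real.dist_eq, abs_of_pos] <;> linarith [hq.1, hq.2])
    have hlt := mul_lt_mul_of_pos_right hFq (sub_pos.2 hr.1)
    rw [← heq, hus, one_div_mul_eq_div, lt_div_iff₀ hc] at hlt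
    linarith
  obtain ⟨r, hr, heq⟩ := exists_sub_eq_sddeRHS_mul hu hd hs hsb
  have hFr := sddeRHS_neg_of_Nzero_lt hc hσμ hμ hlow (hdelay r hr)
    (hN.trans_lt (habove r hr.1 (hr.2.le.trans (min_le_left _ _))))
  have hneg := mul_neg_of_neg_of_pos hFr (sub_pos.2 hsb)
  linarith [habove _ hsb (min_le_left _ _)]

lemma exists_ge_solution_le (ha : 0 < a) (hc : 0 < c) (hσμ : σ ≤ μ) (hμ : μ < 0)
    (hu : Continuous u) (hd : ∀ t > 0, HasDerivAt u (sddeRHS a c μ σ u t) t) (hN : 0 < N)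
    (hup : ∀ t ≥ 0, u t ≤ N) (hv : 0 < v) (T : ℝ) : ∃ t ≥ T, u t ≤ v := by
  by_contra! habove
  have hcN : 0 < c * N := by positivity
  set R := max T 0 + a + c * N with hR
  have hT := le_max_left T 0
  have h0 := le_max_right T 0
  have hrate : 0 < -(μ + σ) * v := mul_pos (by linarith) hv
  have hL : 0 < N / (-(μ + σ) * v) := by positivity
  obtain ⟨r, hr, heq⟩ := exists_sub_eq_sddeRHS_mul hu hd (s := R)
    (t := R + N / (-(μ + σ) * v)) (by linarith) (by linarith)
  have hFr : sddeRHS a c μ σ u r ≤ -(-(μ + σ) * v) := by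
    have h1 := habove r (by linarith [hr.1])
    have h2 := habove (r - a - c * u r) (by
      nlinarith [hr.1, mul_le_mul_of_nonneg_left (hup r (by linarith [hr.1])) hc.le])
    unfold sddeRHS
    nlinarith
  have hmul := mul_le_mul_of_nonneg_right hFr hL.le
  rw [neg_mul (-(μ + σ) * v), mul_div_cancel₀ _ hrate.ne'] at hmul
  rw [add_sub_cancel_left] at heq
  linarith [hup R (by linarith), habove (R + N / (-(μ + σ) * v)) (by linarith)]

lemma exists_ge_le_solution (ha : 0 < a) (hc : 0 < c) (hσμ : σ ≤ μ) (hμ : μ < 0)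
    (hu : Continuous u) (hd : ∀ t > 0, HasDerivAt u (sddeRHS a c μ σ u t) t)
    (hlow : ∀ t ≥ 0, Mzero a c ≤ u t) (hv : v < 0) (T : ℝ) : ∃ t ≥ T, v ≤ u t := by
  by_contra! hbelow
  have hneg : Mzero a c < 0 := div_neg_of_neg_of_pos (by linarith) hc
  set R := max T 0 + a with hR
  have hT := le_max_left T 0
  have h0 := le_max_right T 0
  have hrate : 0 < (μ + σ) * v := mul_pos_of_neg_of_neg (by linarith) hv
  have hL : 0 < -Mzero a c / ((μ + σ) * v) := div_pos (by linarith) hrate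
  obtain ⟨r, hr, heq⟩ := exists_sub_eq_sddeRHS_mul hu hd (s := R)
    (t := R + -Mzero a c / ((μ + σ) * v)) (by linarith) (by linarith)
  have hFr : (μ + σ) * v ≤ sddeRHS a c μ σ u r := by
    have h1 := hbelow r (by linarith [hr.1])
    have h2 := hbelow (r - a - c * u r) (by nlinarith [hr.1])
    unfold sddeRHS
    nlinarith
  have hmul := mul_le_mul_of_nonneg_right hFr hL.le
  rw [mul_div_cancel₀ _ hrate.ne'] at hmul
  rw [add_sub_cancel_left] at heq
  linarith [hlow R (by linarith), hbelow (R + -Mzero a c / ((μ + σ) * v)) (by linarith)]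

lemma exists_forall_solution_le_Nzero (ha : 0 < a) (hc : 0 < c) (hσμ : σ ≤ μ) (hμ : μ < 0)
    (hu : Continuous u) (hd : ∀ t > 0, HasDerivAt u (sddeRHS a c μ σ u t) t) (hN : 0 < N)
    (hup : ∀ t ≥ 0, u t ≤ N) (hlow : ∀ t ≥ -(a + c * N), Mzero a c ≤ u t) :
    ∃ T ≥ 0, ∀ t ≥ T, u t ≤ Nzero a c μ σ := by
  obtain ⟨T, hT, huT⟩ := exists_ge_solution_le ha hc hσμ hμ hu hd hN hup
    (Nzero_pos ha hc hσμ hμ) 0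
  refine ⟨T, hT, fun t ht => ?_⟩
  by_contra! hlt
  obtain ⟨s, hs, hst, hus, habove⟩ := exists_last_le hu ht huT hlt
  have hs0 : 0 ≤ s := le_trans hT hs
  obtain ⟨r, hr, heq⟩ := exists_sub_eq_sddeRHS_mul hu hd hs0 hst
  have hdelay : -(a + c * N) ≤ r - a - c * u r := by
    nlinarith [hr.1, mul_le_mul_of_nonneg_left (hup r (by linarith [hr.1])) hc.le]
  have hFr := sddeRHS_neg_of_Nzero_lt hc hσμ hμ hlow hdelay (habove r hr.1 hr.2.le)
  linarith [mul_neg_of_neg_of_pos hFr (sub_pos.2 hst)]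

/-- At a late critical point, an eventual lower bound `x` controls `Q₁(u(t), x)` from above. -/
lemma Qone_nonpos_of_critical (ha : 0 < a) (hc : 0 < c) (hσμ : σ ≤ μ) (hμ : μ < 0)
    (hu : Continuous u) (hd : ∀ t > 0, HasDerivAt u (sddeRHS a c μ σ u t) t) (hN : 0 < N)
    (hup : ∀ t ≥ 0, u t ≤ N) (hlow : ∀ t ≥ 0, Mzero a c ≤ u t) {T t : ℝ} (hT : 0 ≤ T)
    (hx : ∀ t ≥ T, x ≤ u t) (ht : T + 2 * (a + c * N) ≤ t) (hcrit : sddeRHS a c μ σ u t = 0) :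
    Qone a c μ σ (u t) x ≤ 0 := by
  have hσ : σ < 0 := hσμ.trans_lt hμ
  have hcN : 0 < c * N := by positivity
  have hut := mul_le_mul_of_nonneg_left (hup t (by linarith)) hc.le
  have hdel : 0 ≤ a + c * u t := by
    have := (div_le_iff₀ hc).1 (hlow t (by linarith))
    linarith
  have key := add_div_le_exp_mul_of_deriv_le (f := u) (b := σ * x) (t₀ := t - a - c * u t)
    (t₁ := t) hμ.ne (by linarith) hu (fun r hr => hd r (by linarith [hr.1])) (by
      intro r hr
      have hur := mul_le_mul_of_nonneg_left (hup r (by linarith [hr.1])) hc.le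
      have := mul_le_mul_of_nonpos_left (hx (r - a - c * u r) (by linarith [hr.1])) hσ.le
      unfold sddeRHS
      linarith)
  have hval : u (t - a - c * u t) = -(μ / σ * u t) := by
    unfold sddeRHS at hcrit
    refine mul_left_cancel₀ hσ.ne ?_
    rw [mul_neg, ← mul_assoc, mul_div_cancel₀ _ hσ.ne]
    linarith
  rw [hval, show t - (t - a - c * u t) = a + c * u t by ring] at key
  unfold Qone
  rw [mul_div_right_comm] at key
  linarith

/-- At a late critical point, an eventual upper bound `x` controls `Q₁(u(t), x)` from below. -/
lemma Qone_nonneg_of_critical (ha : 0 < a) (hc : 0 < c) (hσμ : σ ≤ μ) (hμ : μ < 0)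
    (hu : Continuous u) (hd : ∀ t > 0, HasDerivAt u (sddeRHS a c μ σ u t) t) (hN : 0 < N)
    (hup : ∀ t ≥ 0, u t ≤ N) (hlow : ∀ t ≥ 0, Mzero a c ≤ u t) {T t : ℝ} (hT : 0 ≤ T)
    (hx : ∀ t ≥ T, u t ≤ x) (ht : T + 2 * (a + c * N) ≤ t) (hcrit : sddeRHS a c μ σ u t = 0) :
    0 ≤ Qone a c μ σ (u t) x := by
  have hσ : σ < 0 := hσμ.trans_lt hμ
  have hcN : 0 < c * N := by positivity
  have hut := mul_le_mul_of_nonneg_left (hup t (by linarith)) hc.le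
  have hdel : 0 ≤ a + c * u t := by
    have := (div_le_iff₀ hc).1 (hlow t (by linarith))
    linarith
  have key := add_div_le_exp_mul_of_deriv_le (f := fun t => -u t) (b := -(σ * x))
    (f' := fun t => -sddeRHS a c μ σ u t) (t₀ := t - a - c * u t)
    (t₁ := t) hμ.ne (by linarith) hu.neg (fun r hr => (hd r (by linarith [hr.1])).neg) (by
      intro r hr
      have hur := mul_le_mul_of_nonneg_left (hup r (by linarith [hr.1])) hc.le
      have := mul_le_mul_of_nonpos_left (hx (r - a - c * u r) (by linarith [hr.1])) hσ.le
      unfold sddeRHS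
      linarith)
  have hval : u (t - a - c * u t) = -(μ / σ * u t) := by
    unfold sddeRHS at hcrit
    refine mul_left_cancel₀ hσ.ne ?_
    rw [mul_neg, ← mul_assoc, mul_div_cancel₀ _ hσ.ne]
    linarith
  simp only [hval] at key
  rw [show t - (t - a - c * u t) = a + c * u t by ring, neg_div, mul_div_right_comm] at key
  unfold Qone
  linarith

/-- A continuous function that is both at or below a level and above it at arbitrarily late
times has arbitrarily late local maxima above that level. -/
lemma exists_isLocalMax_of_frequently {f : ℝ → ℝ} (hf : Continuous f) {K : ℝ}
    (hle : ∀ T, ∃ t ≥ T, f t ≤ K) (hlt : ∀ T, ∃ t ≥ T, K < f t) (T : ℝ) :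
    ∃ t ≥ T, K < f t ∧ IsLocalMax f t := by
  obtain ⟨t₁, ht₁, h₁⟩ := hle T
  obtain ⟨t₂, ht₂, h₂⟩ := hlt t₁
  obtain ⟨t₃, ht₃, h₃⟩ := hle t₂
  obtain ⟨t, ht, hmax⟩ := isCompact_Icc.exists_isMaxOn (s := Icc t₁ t₃)
    ⟨t₂, ht₂, ht₃⟩ hf.continuousOn
  have hKt : K < f t := h₂.trans_le (hmax ⟨ht₂, ht₃⟩)
  have hne₁ : t₁ ≠ t := by rintro rfl; linarith
  have hne₃ : t ≠ t₃ := by rintro rfl; linarith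
  exact ⟨t, le_trans ht₁ ht.1, hKt,
    hmax.isLocalMax (Icc_mem_nhds (lt_of_le_of_ne ht.1 hne₁) (lt_of_le_of_ne ht.2 hne₃))⟩

lemma exists_forall_solution_le (ha : 0 < a) (hc : 0 < c) (hσμ : σ ≤ μ) (hμ : μ < 0)
    (hu : Continuous u) (hd : ∀ t > 0, HasDerivAt u (sddeRHS a c μ σ u t) t) (hN : 0 < N)
    (hup : ∀ t ≥ 0, u t ≤ N) (hlow : ∀ t ≥ 0, Mzero a c ≤ u t) {T : ℝ} (hT : 0 ≤ T)
    (hx : ∀ t ≥ T, x ≤ u t) (hv : 0 < v) (hQ : Qone a c μ σ v x = 0) :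
    ∃ T', ∀ t ≥ T', u t ≤ v := by
  by_contra! hlt
  have hcN : 0 < c * N := by positivity
  obtain ⟨t, ht, hvt, hmax⟩ := exists_isLocalMax_of_frequently hu
    (exists_ge_solution_le ha hc hσμ hμ hu hd hN hup hv) hlt (T + 2 * (a + c * N))
  have hcrit := hmax.hasDerivAt_eq_zero (hd t (by linarith))
  have hM : Mzero a c < 0 := div_neg_of_neg_of_pos (by linarith) hc
  exact absurd (Qone_nonpos_of_critical ha hc hσμ hμ hu hd hN hup hlow hT hx ht hcrit)
    (not_le.2 (Qone_pos_of_nonneg_of_lt ha hc hσμ hμ (hM.trans hv).le hQ.ge hvt))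

lemma exists_forall_le_solution (ha : 0 < a) (hc : 0 < c) (hσμ : σ ≤ μ) (hμ : μ < 0)
    (hu : Continuous u) (hd : ∀ t > 0, HasDerivAt u (sddeRHS a c μ σ u t) t) (hN : 0 < N)
    (hup : ∀ t ≥ 0, u t ≤ N) (hlow : ∀ t ≥ 0, Mzero a c ≤ u t) {T : ℝ} (hT : 0 ≤ T)
    (hx : ∀ t ≥ T, u t ≤ x) (hv : v < 0) (hQ : Qone a c μ σ v x = 0) :
    ∃ T', ∀ t ≥ T', v ≤ u t := by
  by_contra! hlt
  have hcN : 0 < c * N := by positivity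
  obtain ⟨t, ht, hvt, hmax⟩ := exists_isLocalMax_of_frequently hu.neg (K := -v)
    (by simpa using exists_ge_le_solution ha hc hσμ hμ hu hd hlow hv)
    (by simpa using hlt) (T + 2 * (a + c * N))
  have hvt : u t < v := neg_lt_neg_iff.1 hvt
  have hcrit := neg_eq_zero.1 (hmax.hasDerivAt_eq_zero (hd t (by linarith)).neg)
  exact absurd hQ (Qone_pos_of_nonneg_of_lt ha hc hσμ hμ (hlow t (by linarith))
    (Qone_nonneg_of_critical ha hc hσμ hμ hu hd hN hup hlow hT hx ht hcrit) hvt).ne'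

/-- A zero of `Q₁(·, x)` with `x ≠ 0` is nonzero. -/
lemma ne_zero_of_Qone_eq_zero (ha : 0 < a) (hσμ : σ ≤ μ) (hμ : μ < 0)
    (hx : x ≠ 0) (hQ : Qone a c μ σ v x = 0) : v ≠ 0 := by
  rintro rfl
  have hE : exp (μ * a) < 1 := exp_lt_one_iff.2 (mul_neg_of_neg_of_pos hμ ha)
  have hσ : σ ≠ 0 := (hσμ.trans_lt hμ).ne
  unfold Qone at hQ
  simp only [mul_zero, add_zero, zero_add] at hQ
  exact mul_ne_zero (mul_ne_zero (div_ne_zero hσ hμ.ne) hx) (by linarith) hQ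

end Auxiliary

/-- Recursive shrinking bounds on solutions, first-order version. -/
theorem sdde_shrinking_bounds_Q1
    (a c μ σ N τ : ℝ) (φ u : ℝ → ℝ) (Ms Ns : ℕ → ℝ)
    (ha : 0 < a) (hc : 0 < c) (hσμ : σ ≤ μ) (hμ : μ < 0)
    (hN : N = max (Nzero a c μ σ) (φ 0)) (hτ : τ = a + c * N)
    (hφcont : Continuous φ)
    (hφ : ∀ t ∈ Set.Icc (-τ) (0:ℝ), Mzero a c ≤ φ t)
    (hu : IsSDDESolution a c μ σ φ u)
    (hM0 : Ms 0 = Mzero a c) (hN0 : Ns 0 = Nzero a c μ σ)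
    (hrecM : ∀ n, Ms (n + 1) ∈ Set.Icc (Mzero a c) (0:ℝ) ∧
      Qone a c μ σ (Ms (n + 1)) (Ns n) = 0)
    (hrecN : ∀ n, Ns (n + 1) ∈ Set.Icc (0:ℝ) (Nzero a c μ σ) ∧
      Qone a c μ σ (Ns (n + 1)) (Ms n) = 0) :
    ∀ n : ℕ, ∃ T ≥ (0:ℝ), ∀ t ≥ T, u t ∈ Set.Icc (Ms n) (Ns n) := by
  obtain ⟨hucont, hhist, -, hd⟩ := hu
  have hN0pos := Nzero_pos (a := a) (c := c) ha hc hσμ hμ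
  have hM0neg : Mzero a c < 0 := div_neg_of_neg_of_pos (by linarith) hc
  have hNN : Nzero a c μ σ ≤ N := hN ▸ le_max_left _ _
  have hNpos : 0 < N := hN0pos.trans_le hNN
  have hτpos : 0 < τ := by rw [hτ]; positivity
  have hlow : ∀ t ≥ 0, Mzero a c ≤ u t := fun t ht =>
    Mzero_le_of_solution ha hc hσμ hμ hucont hd
      (by rw [hhist 0 le_rfl]; exact hφ 0 ⟨by linarith, le_rfl⟩) ht
  have hlowτ : ∀ t ≥ -(a + c * N), Mzero a c ≤ u t := by
    intro t ht
    rcases le_total 0 t with h | h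
    · exact hlow t h
    · rw [hhist t h]
      exact hφ t ⟨by rw [hτ]; exact ht, h⟩
  have hup : ∀ t ≥ 0, u t ≤ N := fun t ht =>
    le_of_solution hc hσμ hμ hucont hd hNN hlowτ
      (by rw [hhist 0 le_rfl, hN]; exact le_max_right _ _) ht
  have hsign : ∀ n, Ms n < 0 ∧ 0 < Ns n := by
    intro n
    induction n with
    | zero => rw [hM0, hN0]; exact ⟨hM0neg, hN0pos⟩
    | succ n ih =>
      obtain ⟨hMmem, hMQ⟩ := hrecM n
      obtain ⟨hNmem, hNQ⟩ := hrecN n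
      exact ⟨lt_of_le_of_ne hMmem.2 (ne_zero_of_Qone_eq_zero ha hσμ hμ ih.2.ne' hMQ),
        lt_of_le_of_ne hNmem.1 (ne_zero_of_Qone_eq_zero ha hσμ hμ ih.1.ne hNQ).symm⟩
  intro n
  induction n with
  | zero =>
    obtain ⟨T, hT, h⟩ := exists_forall_solution_le_Nzero ha hc hσμ hμ hucont hd hNpos hup hlowτ
    rw [hM0, hN0]
    exact ⟨T, hT, fun t ht => ⟨hlow t (le_trans hT ht), h t ht⟩⟩
  | succ n ih =>
    obtain ⟨T, hT, h⟩ := ih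
    obtain ⟨T₁, h₁⟩ := exists_forall_solution_le ha hc hσμ hμ hucont hd hNpos hup hlow hT
      (fun t ht => (h t ht).1) (hsign (n + 1)).2 (hrecN n).2
    obtain ⟨T₂, h₂⟩ := exists_forall_le_solution ha hc hσμ hμ hucont hd hNpos hup hlow hT
      (fun t ht => (h t ht).2) (hsign (n + 1)).1 (hrecM n).2
    refine ⟨max T (max T₁ T₂), le_max_of_le_left hT, fun t ht => ⟨h₂ t ?_, h₁ t ?_⟩⟩
    · exact ((le_max_right _ _).trans (le_max_right _ _)).trans ht
    · exact ((le_max_left _ _).trans (le_max_right _ _)).trans ht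
end

section
/- (Recursive shrinking bounds, second-order version.) Let a > 0, c > 0 and σ ≤ μ < 0. Set N = max{N₀, φ(0)} and τ = a + c·N, and suppose φ is continuous with φ(t) ≥ M₀ for all t ∈ [−τ, 0]. Let u be a solution of the SDDE. Let (Mₙ)ₙ≥0 and (Nₙ)ₙ≥0 be real sequences with M_0 = M₀, N_0 = N₀, and for every n: M_{n+1} ∈ [M₀, 0] with Q₂(M_{n+1}, Nₙ, Mₙ) = 0, and N_{n+1} ∈ [0, N₀] with Q₂(N_{n+1}, Mₙ, Nₙ) = 0. Then for every n there exists Tₙ ≥ 0 such that u(t) ∈ [Mₙ, Nₙ] for all t ≥ Tₙ. -/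
open Real Set Filter

/-- `D(x,y) = (|μ|+|σ|)(1 + (|μ|+|σ|) max(|x|,|y|) c) max(|x|,|y|)`. -/
noncomputable def Dfun (c μ σ x y : ℝ) : ℝ :=
  (|μ| + |σ|) * (1 + (|μ| + |σ|) * max |x| |y| * c) * max |x| |y|

/-- The piecewise function `Q₂(v,x,y)`. -/
noncomputable def Qtwo (a c μ σ v x y : ℝ) : ℝ :=
  let s := Real.sign (y - x)
  let D := Dfun c μ σ x y
  if -s * (x + (μ / σ) * v) / D < a + c * v then
    (μ / σ) * v * Real.exp (μ * (a + c * v)) -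
      (σ / μ) * (s * (D / μ) *
        (Real.exp (-μ * s * (x + (μ / σ) * v) / D) - 1) +
        x * Real.exp (μ * (a + c * v)))
  else
    v * Real.exp (μ * (a + c * v)) * (1 + μ / σ) -
      s * (σ / μ) * D *
        ((1 / μ) * (Real.exp (μ * (a + c * v)) - 1) -
          (a + c * v) * Real.exp (μ * (a + c * v)))

/-- The comparison expression at a critical value when the saturated bound `X` is reached. -/
noncomputable def saturatedGap (p E X z ρ : ℝ) : ℝ :=
  exp (-ρ) * (z + p * X) - p * E * (1 - exp (-((X - z) / E)))

/-- The comparison expression at a critical value when only the Lipschitz bound is used. -/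
noncomputable def lipschitzGap (p E z ρ : ℝ) : ℝ :=
  z * exp (-ρ) * (1 + p) - p * E * (1 - exp (-ρ) - ρ * exp (-ρ))

/-- The normalized form of `Qtwo`, with `z` the rescaled critical value and `ρ` the rescaled
delay. -/
noncomputable def criticalGap (p E X z ρ : ℝ) : ℝ :=
  if (X - z) / E < ρ then saturatedGap p E X z ρ else lipschitzGap p E z ρ

lemma saturatedGap_eq_lipschitzGap {p E X z ρ : ℝ} (hE : 0 < E) (h : (X - z) / E = ρ) :
    saturatedGap p E X z ρ = lipschitzGap p E z ρ := by
  have hX : X = z + E * ρ := by rw [← h]; field_simp; ring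
  unfold saturatedGap lipschitzGap
  rw [h, hX]; ring

lemma criticalGap_zero_neg {p E X A : ℝ} (hp : 1 ≤ p) (hE : 0 < E) (hX : 0 < X) (hA : 0 < A) :
    criticalGap p E X 0 A < 0 := by
  unfold criticalGap
  have hpE : 0 < p * E := by positivity
  split_ifs with h
  · unfold saturatedGap
    simp only [sub_zero] at *
    set y := X / E with hy
    have hXy : X = E * y := by rw [hy]; field_simp
    have hy0 : 0 < y := by positivity
    have h1 : exp (-A) < exp (-y) := exp_lt_exp.2 (by linarith)
    have h2 : exp y * exp (-y) = 1 := by rw [← exp_add]; simp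
    have h3 : y + 1 ≤ exp y := add_one_le_exp y
    have h4 : (y + 1) * exp (-y) ≤ 1 :=
      (mul_le_mul_of_nonneg_right h3 (exp_pos _).le).trans_eq h2
    have h5 : y * exp (-A) < y * exp (-y) := mul_lt_mul_of_pos_left h1 hy0
    have h6 : y * exp (-A) < 1 - exp (-y) := by linarith
    rw [hXy]
    nlinarith [mul_lt_mul_of_pos_left h6 hpE]
  · unfold lipschitzGap
    have h2 : exp A * exp (-A) = 1 := by rw [← exp_add]; simp
    have h3 : A + 1 < exp A := add_one_lt_exp hA.ne'
    have h4 : (A + 1) * exp (-A) < 1 :=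
      (mul_lt_mul_of_pos_right h3 (exp_pos _)).trans_eq h2
    have : 0 < p * E * (1 - exp (-A) - A * exp (-A)) := mul_pos hpE (by linarith)
    linarith

lemma exists_branch_switch {A b E X z₀ z : ℝ} (hz : z₀ ≤ z)
    (h : (A + b * z₀ - (X - z₀) / E ≤ 0 ∧ 0 ≤ A + b * z - (X - z) / E) ∨
      (0 ≤ A + b * z₀ - (X - z₀) / E ∧ A + b * z - (X - z) / E ≤ 0)) :
    ∃ w ∈ Icc z₀ z, (X - w) / E = A + b * w := by
  have hcont : ContinuousOn (fun w => A + b * w - (X - w) / E) (Icc z₀ z) := by fun_prop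
  have : (0 : ℝ) ∈ (fun w => A + b * w - (X - w) / E) '' Icc z₀ z := by
    rcases h with h | h
    · exact intermediate_value_Icc hz hcont h
    · exact intermediate_value_Icc' hz hcont ⟨h.2, h.1⟩
  obtain ⟨w, hw, hw0⟩ := this
  exact ⟨w, hw, by simp only at hw0; linarith⟩

lemma saturatedGap_lt_of_decreasing_delay {p E X A z₁ z₂ : ℝ} (hp : 1 ≤ p) (hE : 0 < E)
    (hX : 0 < X) (hz₁ : 0 ≤ z₁) (hz : z₁ < z₂) :
    saturatedGap p E X z₁ (A + -p * z₁) < saturatedGap p E X z₂ (A + -p * z₂) := by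
  unfold saturatedGap
  have h1 : exp (-(A + -p * z₁)) ≤ exp (-(A + -p * z₂)) := exp_le_exp.2 (by nlinarith)
  have h2 : exp (-(A + -p * z₁)) * (z₁ + p * X) ≤ exp (-(A + -p * z₂)) * (z₂ + p * X) :=
    mul_le_mul h1 (by linarith) (by positivity) (exp_pos _).le
  have h3 : exp (-((X - z₁) / E)) < exp (-((X - z₂) / E)) :=
    exp_lt_exp.2 (neg_lt_neg (div_lt_div_of_pos_right (by linarith) hE))
  have hpE : 0 < p * E := by positivity
  nlinarith [mul_lt_mul_of_pos_left h3 hpE]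

lemma one_add_mul_exp_neg_le {r s : ℝ} (hr : 0 ≤ r) (h : r ≤ s) :
    (1 + s) * exp (-s) ≤ (1 + r) * exp (-r) := by
  have h1 : exp (-r) = exp (s - r) * exp (-s) := by rw [← exp_add]; congr 1; ring
  rw [h1, ← mul_assoc]
  refine mul_le_mul_of_nonneg_right ?_ (exp_pos _).le
  nlinarith [add_one_le_exp (s - r), mul_nonneg hr (sub_nonneg.2 h)]

lemma lipschitzGap_lt_of_decreasing_delay {p E A z₁ z₂ : ℝ} (hp : 1 ≤ p) (hE : 0 < E)
    (hz₁ : 0 ≤ z₁) (hz : z₁ < z₂) (hA : p * z₂ ≤ A) :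
    lipschitzGap p E z₁ (A + -p * z₁) < lipschitzGap p E z₂ (A + -p * z₂) := by
  unfold lipschitzGap
  have h1 : exp (-(A + -p * z₁)) ≤ exp (-(A + -p * z₂)) := exp_le_exp.2 (by nlinarith)
  have h2 : z₁ * exp (-(A + -p * z₁)) < z₂ * exp (-(A + -p * z₂)) :=
    (mul_le_mul_of_nonneg_left h1 hz₁).trans_lt (mul_lt_mul_of_pos_right hz (exp_pos _))
  have h3 := one_add_mul_exp_neg_le (r := A + -p * z₂) (s := A + -p * z₁) (by linarith)
    (by nlinarith)
  have hpE : 0 < p * E := by positivity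
  nlinarith [mul_le_mul_of_nonneg_left h3 hpE.le,
    mul_lt_mul_of_pos_right h2 (by linarith : 0 < 1 + p)]

lemma criticalGap_pos_of_decreasing_delay {p E X A z₀ z : ℝ} (hp : 1 ≤ p) (hE : 0 < E)
    (hX : 0 < X) (hz₀ : 0 ≤ z₀) (hz : z₀ < z) (hA : p * z ≤ A)
    (h0 : criticalGap p E X z₀ (A + -p * z₀) = 0) : 0 < criticalGap p E X z (A + -p * z) := by
  unfold criticalGap at *
  by_cases h1 : (X - z₀) / E < A + -p * z₀ <;> by_cases h2 : (X - z) / E < A + -p * z <;>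
    simp only [h1, h2, if_true, if_false] at h0 ⊢
  · rw [← h0]; exact saturatedGap_lt_of_decreasing_delay hp hE hX hz₀ hz
  · obtain ⟨w, hw, he⟩ := exists_branch_switch (A := A) (b := -p) (E := E) (X := X) hz.le
      (Or.inr ⟨by linarith, by linarith⟩)
    have hne : z₀ < w := lt_of_le_of_ne hw.1 (by rintro rfl; linarith)
    have h3 := saturatedGap_lt_of_decreasing_delay (A := A) hp hE hX hz₀ hne
    rw [h0, saturatedGap_eq_lipschitzGap hE he] at h3
    rcases hw.2.eq_or_lt with rfl | h4
    · exact h3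
    · exact h3.trans (lipschitzGap_lt_of_decreasing_delay hp hE (hz₀.trans hw.1) h4 hA)
  · obtain ⟨w, hw, he⟩ := exists_branch_switch (A := A) (b := -p) (E := E) (X := X) hz.le
      (Or.inl ⟨by linarith, by linarith⟩)
    have hne : w < z := lt_of_le_of_ne hw.2 (by rintro rfl; linarith)
    have h3 := saturatedGap_lt_of_decreasing_delay (A := A) hp hE hX (hz₀.trans hw.1) hne
    rw [saturatedGap_eq_lipschitzGap hE he] at h3
    rcases hw.1.eq_or_lt with rfl | h4
    · rwa [h0] at h3
    · have := lipschitzGap_lt_of_decreasing_delay (A := A) (E := E) hp hE hz₀ h4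
        (by nlinarith [hw.2])
      linarith
  · rw [← h0]; exact lipschitzGap_lt_of_decreasing_delay hp hE hz₀ hz hA

/-- If the Lipschitz branch is active, the bound `X` is small compared with `p`. -/
lemma bounds_of_lipschitz_branch {p E X A z : ℝ} (hp : 1 ≤ p) (hX : 0 < X) (hXA : X ≤ A)
    (hE : (1 + p) * (1 + (1 + p) * X) * X ≤ E) (hz : 0 ≤ z) (h : A + p * z ≤ (X - z) / E) :
    E * (A + p * z) ≤ X ∧ A + p * z ≤ 1 / 2 ∧ (1 + p) * X ≤ 2 / 3 := by
  have hE0 : 0 < E := lt_of_lt_of_le (by positivity) hE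
  rw [le_div_iff₀ hE0] at h
  have hpz : 0 ≤ p * z := by positivity
  set r := A + p * z
  have hXr : X ≤ r := by simp only [r]; linarith
  have h1 : E * r ≤ X := by linarith
  have h2 : (1 + p) * (1 + (1 + p) * X) * X * r ≤ X :=
    (mul_le_mul_of_nonneg_right hE (by linarith)).trans h1
  have h3 : (1 + p) * (1 + (1 + p) * X) * r ≤ 1 := by
    by_contra hcon
    push Not at hcon
    nlinarith
  have h4 : (1 + p) * (1 + (1 + p) * X) * X ≤ 1 :=
    (mul_le_mul_of_nonneg_left hXr (by positivity)).trans h3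
  refine ⟨h1, ?_, ?_⟩
  · nlinarith [mul_nonneg (mul_nonneg (by linarith : 0 ≤ 1 + p) (by positivity : 0 ≤ (1 + p) * X))
      (by linarith : 0 ≤ r)]
  · nlinarith

lemma lipschitzGap_pos_of_increasing_delay {p E X A z₁ z₂ : ℝ} (hp : 1 ≤ p) (hX : 0 < X)
    (hXA : X ≤ A) (hE : (1 + p) * (1 + (1 + p) * X) * X ≤ E) (hz₁ : 0 ≤ z₁) (hz : z₁ < z₂)
    (h : A + p * z₂ ≤ (X - z₂) / E) (h0 : 0 ≤ lipschitzGap p E z₁ (A + p * z₁)) :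
    0 < lipschitzGap p E z₂ (A + p * z₂) := by
  obtain ⟨hEr, hr, hq⟩ := bounds_of_lipschitz_branch hp hX hXA hE (hz₁.trans hz.le) h
  have hE0 : 0 < E := lt_of_lt_of_le (by positivity) hE
  have key : ∀ z ρ, lipschitzGap p E z ρ
      = exp (-ρ) * (z * (1 + p) - p * E * (exp ρ - 1 - ρ)) := by
    intro z ρ
    have h2 : exp (-ρ) * exp ρ = 1 := by rw [← exp_add]; simp
    unfold lipschitzGap
    linear_combination (p * E) * h2
  rw [key] at h0 ⊢
  refine mul_pos (exp_pos _) ?_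
  have h0' := nonneg_of_mul_nonneg_right h0 (exp_pos _)
  set r₂ := A + p * z₂ with hr₂
  set r₁ := A + p * z₁ with hr₁
  have hr₂0 : 0 < r₂ := by have : 0 < p * z₂ := mul_pos (by linarith) (by linarith)
                           linarith
  have hdiff : r₂ - r₁ = p * (z₂ - z₁) := by rw [hr₁, hr₂]; ring
  have h1 : exp r₂ - exp r₁ ≤ p * (z₂ - z₁) * exp r₂ := by
    have h2 : exp r₁ = exp (r₁ - r₂) * exp r₂ := by rw [← exp_add]; congr 1; ring
    have h3 := mul_le_mul_of_nonneg_right (add_one_le_exp (r₁ - r₂)) (exp_pos r₂).le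
    rw [← h2] at h3
    rw [← hdiff]; linarith
  have h2 : exp r₂ - 1 ≤ r₂ + r₂ ^ 2 := by
    have := abs_exp_sub_one_sub_id_le (x := r₂) (by rw [abs_of_pos hr₂0]; linarith)
    linarith [le_abs_self (exp r₂ - 1 - r₂)]
  have h3 : E * (exp r₂ - 1) ≤ X * (3 / 2) := by
    have := mul_le_mul_of_nonneg_left h2 hE0.le
    nlinarith
  have h4 : p * p * (E * (exp r₂ - 1)) ≤ p := by
    have h5 := mul_le_mul_of_nonneg_left h3 (by positivity : 0 ≤ p * p)
    have h6 : p * X ≤ 2 / 3 := by linarith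
    nlinarith
  have h5 := mul_le_mul_of_nonneg_left h1 (by positivity : 0 ≤ p * E)
  nlinarith [mul_le_mul_of_nonneg_right h4 (by linarith : 0 ≤ z₂ - z₁)]

lemma hasDerivAt_saturatedGap {p E X A : ℝ} (hE : 0 < E) (z : ℝ) :
    HasDerivAt (fun z => saturatedGap p E X z (A + p * z))
      (exp (-(A + p * z)) * (1 - p * z - p * p * X) + p * exp (-((X - z) / E))) z := by
  unfold saturatedGap
  have h1 : HasDerivAt (fun z : ℝ => -(A + p * z)) (-p) z := by
    simpa using (((hasDerivAt_id z).const_mul p).const_add A).fun_neg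
  have h2 : HasDerivAt (fun z : ℝ => -((X - z) / E)) (1 / E) z := by
    have := (((hasDerivAt_id z).const_sub X).div_const E).fun_neg
    simpa [neg_div] using this
  have h3 : HasDerivAt (fun z : ℝ => z + p * X) 1 z := (hasDerivAt_id z).add_const _
  have := (h1.exp.mul h3).sub ((h2.exp.const_sub 1).const_mul (p * E))
  refine this.congr_deriv ?_
  field_simp
  ring

lemma saturatedGap_lt_of_increasing_delay {p E X A z₁ z₂ : ℝ} (hp : 1 ≤ p) (hX : 0 < X)
    (hXA : X ≤ A) (hE : (1 + p) * (1 + (1 + p) * X) * X ≤ E) (hpX : (p - 1) * X ≤ 1)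
    (hz₁ : 0 ≤ z₁) (hz : z₁ < z₂) :
    saturatedGap p E X z₁ (A + p * z₁) < saturatedGap p E X z₂ (A + p * z₂) := by
  have hE0 : 0 < E := lt_of_lt_of_le (by positivity) hE
  have hmono : StrictMonoOn (fun z => saturatedGap p E X z (A + p * z)) (Ici 0) := by
    apply strictMonoOn_of_deriv_pos (convex_Ici 0)
    · exact fun z _ => (hasDerivAt_saturatedGap hE0 z).continuousAt.continuousWithinAt
    · intro z hz
      rw [interior_Ici] at hz
      have hz : 0 < z := hz
      rw [(hasDerivAt_saturatedGap hE0 z).deriv]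
      have h1 : exp (-((X - z) / E)) = exp (-(A + p * z)) * exp (A + p * z - (X - z) / E) := by
        rw [← exp_add]; congr 1; ring
      rw [h1]
      have h2 := add_one_le_exp (A + p * z - (X - z) / E)
      have h3 : (X - z) / E ≤ 1 / (1 + p) := by
        rw [div_le_div_iff₀ hE0 (by linarith)]
        have : (1 + p) * X ≤ (1 + p) * (1 + (1 + p) * X) * X := by
          have : 0 ≤ (1 + p) * ((1 + p) * X) * X := by positivity
          nlinarith
        nlinarith
      have h4 : p * (1 / (1 + p)) < 1 := by
        rw [mul_one_div, div_lt_one (by linarith)]; linarith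
      have h5 : 0 < 1 - p * z - p * p * X + p * exp (A + p * z - (X - z) / E) := by
        have h6 := mul_le_mul_of_nonneg_left h2 (by linarith : 0 ≤ p)
        have h7 := mul_le_mul_of_nonneg_left h3 (by linarith : 0 ≤ p)
        have h8 := mul_le_mul_of_nonneg_left hpX (by linarith : 0 ≤ p)
        have h9 := mul_le_mul_of_nonneg_left hXA (by linarith : 0 ≤ p)
        have h10 : 0 ≤ (p - 1) * (p * z) := by
          have : 0 ≤ p - 1 := by linarith
          positivity
        nlinarith
      have := mul_pos (exp_pos (-(A + p * z))) h5
      nlinarith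
  exact hmono hz₁ (hz₁.trans hz.le) hz

lemma convexOn_saturatedGap {p E X A : ℝ} (hp : 1 ≤ p) (hE : 0 < E) (hX : 2 ≤ p * p * X) :
    ConvexOn ℝ (Ici 0) (fun z => saturatedGap p E X z (A + p * z)) := by
  have hd : deriv (fun z => saturatedGap p E X z (A + p * z)) = fun z =>
      exp (-(A + p * z)) * (1 - p * z - p * p * X) + p * exp (-((X - z) / E)) :=
    funext fun z => (hasDerivAt_saturatedGap hE z).deriv
  have hd2 : ∀ z, HasDerivAt (fun z =>
      exp (-(A + p * z)) * (1 - p * z - p * p * X) + p * exp (-((X - z) / E)))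
      (exp (-(A + p * z)) * (p * (p * z + p * p * X - 2)) + p * exp (-((X - z) / E)) / E) z := by
    intro z
    have h1 : HasDerivAt (fun z : ℝ => -(A + p * z)) (-p) z := by
      simpa using (((hasDerivAt_id z).const_mul p).const_add A).fun_neg
    have h2 : HasDerivAt (fun z : ℝ => -((X - z) / E)) (1 / E) z := by
      have := (((hasDerivAt_id z).const_sub X).div_const E).fun_neg
      simpa [neg_div] using this
    have h3 : HasDerivAt (fun z : ℝ => 1 - p * z - p * p * X) (-p) z := by
      simpa using (((hasDerivAt_id z).const_mul p).const_sub 1).sub_const (p * p * X)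
    refine ((h1.exp.mul h3).add (h2.exp.const_mul p)).congr_deriv ?_
    field_simp
    ring
  apply MonotoneOn.convexOn_of_deriv (convex_Ici 0)
  · exact fun z _ => (hasDerivAt_saturatedGap hE z).continuousAt.continuousWithinAt
  · exact fun z _ => (hasDerivAt_saturatedGap hE z).differentiableAt.differentiableWithinAt
  · rw [hd]
    refine MonotoneOn.mono ?_ interior_subset
    apply monotoneOn_of_deriv_nonneg (convex_Ici 0)
    · exact fun z _ => (hd2 z).continuousAt.continuousWithinAt
    · exact fun z _ => (hd2 z).differentiableAt.differentiableWithinAt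
    · intro z hz
      rw [interior_Ici] at hz
      have hz : 0 < z := hz
      rw [(hd2 z).deriv]
      have h1 : 0 ≤ p * z + p * p * X - 2 := by
        have : 0 ≤ p * z := by positivity
        linarith
      positivity

lemma ConvexOn.pos_of_neg_of_nonneg {f : ℝ → ℝ} (hf : ConvexOn ℝ (Ici 0) f) (h0 : f 0 < 0)
    {y z : ℝ} (hy0 : 0 ≤ y) (hy : 0 ≤ f y) (hyz : y < z) : 0 < f z := by
  have hy' : 0 < y := lt_of_le_of_ne hy0 (by rintro rfl; linarith)
  have hz : 0 < z := hy'.trans hyz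
  have h1 : 0 < 1 - y / z := by rw [sub_pos, div_lt_one hz]; exact hyz
  have h2 : 0 < y / z := by positivity
  have := hf.2 (mem_Ici.2 le_rfl) (mem_Ici.2 hz.le) h1.le h2.le (by ring)
  have hcomb : (1 - y / z) • (0 : ℝ) + (y / z) • z = y := by
    simp only [smul_eq_mul]; field_simp; ring
  rw [hcomb] at this
  simp only [smul_eq_mul] at this
  by_contra hcon
  push Not at hcon
  nlinarith [mul_neg_of_pos_of_neg h1 h0, mul_nonpos_of_nonneg_of_nonpos h2.le hcon]

lemma criticalGap_pos_of_increasing_delay {p E X A z₀ z : ℝ} (hp : 1 ≤ p) (hX : 0 < X)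
    (hXA : X ≤ A) (hE : (1 + p) * (1 + (1 + p) * X) * X ≤ E) (hz₀ : 0 ≤ z₀) (hz : z₀ < z)
    (h0 : criticalGap p E X z₀ (A + p * z₀) = 0) : 0 < criticalGap p E X z (A + p * z) := by
  have hE0 : 0 < E := lt_of_lt_of_le (by positivity) hE
  have hbranch : ∀ y y', 0 ≤ y → y ≤ y' → (X - y) / E < A + p * y →
      (X - y') / E < A + p * y' := by
    intro y y' _ hyy h
    have h1 : (X - y') / E ≤ (X - y) / E := div_le_div_of_nonneg_right (by linarith) hE0.le
    nlinarith
  have hsmall : ∀ y, 0 ≤ y → ¬ (X - y) / E < A + p * y → (p - 1) * X ≤ 1 := by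
    intro y hy h
    have := (bounds_of_lipschitz_branch hp hX hXA hE hy (not_lt.1 h)).2.2
    nlinarith
  unfold criticalGap at *
  by_cases h1 : (X - z₀) / E < A + p * z₀ <;> by_cases h2 : (X - z) / E < A + p * z <;>
    simp only [h1, h2, if_true, if_false] at h0 ⊢
  · by_cases hpX : (p - 1) * X ≤ 1
    · rw [← h0]; exact saturatedGap_lt_of_increasing_delay hp hX hXA hE hpX hz₀ hz
    · have h3 : 2 ≤ p * p * X := by
        push Not at hpX
        have : 2 * (p - 1) ≤ p * p := by nlinarith [sq_nonneg (p - 1)]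
        nlinarith
      have h4 : (X - 0) / E < A + p * 0 := by
        by_contra h; exact hpX (hsmall 0 le_rfl h)
      have h5 := criticalGap_zero_neg (p := p) (E := E) hp hE0 hX (hX.trans_le hXA)
      unfold criticalGap at h5
      rw [if_pos (by simpa using h4)] at h5
      exact (convexOn_saturatedGap (A := A) hp hE0 h3).pos_of_neg_of_nonneg
        (by simpa using h5) hz₀ h0.ge hz
  · exact absurd (hbranch z₀ z hz₀ hz.le h1) h2
  · obtain ⟨w, hw, he⟩ := exists_branch_switch (A := A) (b := p) (E := E) (X := X) hz.le
      (Or.inl ⟨by linarith, by linarith⟩)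
    have hne : w < z := lt_of_le_of_ne hw.2 (by rintro rfl; linarith)
    have h3 := saturatedGap_lt_of_increasing_delay hp hX hXA hE (hsmall z₀ hz₀ h1)
      (hz₀.trans hw.1) hne
    rw [saturatedGap_eq_lipschitzGap hE0 he] at h3
    rcases hw.1.eq_or_lt with rfl | h4
    · rwa [h0] at h3
    · exact (lipschitzGap_pos_of_increasing_delay hp hX hXA hE hz₀ h4 he.ge h0.ge).trans h3
  · exact lipschitzGap_pos_of_increasing_delay hp hX hXA hE hz₀ hz (not_lt.1 h2) h0.ge

lemma sub_le_mul_of_hasDerivAt_le {f f' : ℝ → ℝ} {α β C : ℝ} (hαβ : α ≤ β)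
    (hf : ∀ x ∈ Icc α β, HasDerivAt f (f' x) x) (hC : ∀ x ∈ Icc α β, f' x ≤ C) :
    f β - f α ≤ C * (β - α) := by
  refine (convex_Icc α β).image_sub_le_mul_sub_of_deriv_le
    (fun x hx => (hf x hx).continuousAt.continuousWithinAt)
    (fun x hx => (hf x (interior_subset hx)).differentiableAt.differentiableWithinAt)
    (fun x hx => ?_) α (left_mem_Icc.2 hαβ) β (right_mem_Icc.2 hαβ) hαβ
  rw [(hf x (interior_subset hx)).deriv]
  exact hC x (interior_subset hx)

/-- A solution cannot stay above a positive level. -/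
lemma exists_le_of_delay_eq {a c μ σ R T B : ℝ} {u : ℝ → ℝ} (hμ : μ < 0) (hσ : σ < 0)
    (hu : ∀ t > 0, HasDerivAt u (μ * u t + σ * u (t - a - c * u t)) t) (hT : 0 ≤ T) (hR : 0 < R)
    (hdelay : ∀ t ≥ T, a + c * u t ≤ R) (hB : 0 < B) : ∃ t ≥ T, u t ≤ B := by
  by_contra! hcon
  set S := T + R with hS
  obtain ⟨L, hL0, hL⟩ : ∃ L > 0, u S + (μ + σ) * B * L < 0 := by
    have hk : (μ + σ) * B < 0 := mul_neg_of_neg_of_pos (by linarith) hB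
    refine ⟨(|u S| + 1) / (-((μ + σ) * B)), div_pos (by positivity) (by linarith), ?_⟩
    have : (μ + σ) * B * ((|u S| + 1) / (-((μ + σ) * B))) = -(|u S| + 1) := by
      rw [div_neg, mul_neg, mul_div_cancel₀ _ hk.ne]
    rw [this]
    linarith [le_abs_self (u S)]
  have h1 := sub_le_mul_of_hasDerivAt_le (f := u) (C := (μ + σ) * B)
    (by linarith : S ≤ S + L) (fun t ht => hu t (by linarith [ht.1])) (by
      intro t ht
      have h2 := hcon t (by linarith [ht.1])
      have h3 := hcon (t - a - c * u t) (by
        have := hdelay t (by linarith [ht.1])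
        linarith [ht.1])
      nlinarith)
  have h2 := hcon (S + L) (by linarith)
  rw [add_sub_cancel_left] at h1
  linarith

/-- If no critical value beyond some time exceeds `B`, then eventually `u ≤ B`. -/
lemma eventually_le_of_critical_le {a c μ σ R T B : ℝ} {u : ℝ → ℝ} (hμ : μ < 0) (hσ : σ < 0)
    (hcont : Continuous u)
    (hu : ∀ t > 0, HasDerivAt u (μ * u t + σ * u (t - a - c * u t)) t) (hT : 0 ≤ T) (hR : 0 < R)
    (hdelay : ∀ t ≥ T, a + c * u t ≤ R) (hB : 0 < B)
    (hcrit : ∀ t ≥ T, μ * u t + σ * u (t - a - c * u t) = 0 → u t ≤ B) :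
    ∃ S ≥ T, ∀ t ≥ S, u t ≤ B := by
  obtain ⟨t₁, ht₁, hu₁⟩ := exists_le_of_delay_eq hμ hσ hu hT hR hdelay hB
  refine ⟨t₁, ht₁, fun t₂ ht₂ => ?_⟩
  by_contra! hcon
  obtain ⟨t₃, ht₃, hu₃⟩ := exists_le_of_delay_eq hμ hσ hu (hT.trans (ht₁.trans ht₂)) hR
    (fun t ht => hdelay t (ht₁.trans (ht₂.trans ht))) hB
  obtain ⟨s, hs, hmax⟩ := isCompact_Icc.exists_isMaxOn (⟨t₂, ht₂, ht₃⟩ : (Icc t₁ t₃).Nonempty)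
    hcont.continuousOn
  have hs2 : u t₂ ≤ u s := hmax ⟨ht₂, ht₃⟩
  have hs1 : t₁ < s := lt_of_le_of_ne hs.1 (by rintro rfl; linarith)
  have hs3 : s < t₃ := lt_of_le_of_ne hs.2 (by rintro rfl; linarith)
  have h0 := (hmax.isLocalMax (Icc_mem_nhds hs1 hs3)).hasDerivAt_eq_zero
    (hu s (by linarith))
  have := hcrit s (by linarith) h0
  linarith

lemma abs_sub_le_of_delay_eq {a c μ σ R T m : ℝ} {u : ℝ → ℝ}
    (hu : ∀ t > 0, HasDerivAt u (μ * u t + σ * u (t - a - c * u t)) t) (hT : 0 ≤ T) (hR : 0 < R)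
    (hm : ∀ t ≥ T, |u t| ≤ m) (hdelay : ∀ t ≥ T, a + c * u t ≤ R) {s s' : ℝ}
    (hs : T + R ≤ s) (hs' : T + R ≤ s') : |u s - u s'| ≤ (|μ| + |σ|) * m * |s - s'| := by
  have := (convex_Ici (T + R)).norm_image_sub_le_of_norm_hasDerivWithin_le (f := u)
    (C := (|μ| + |σ|) * m) (x := s') (y := s)
    (fun t ht => (hu t (by have := mem_Ici.1 ht; linarith)).hasDerivWithinAt)
    (fun t ht => ?_) hs' hs
  · simpa [Real.norm_eq_abs] using this
  · have ht : T + R ≤ t := ht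
    rw [Real.norm_eq_abs]
    have h1 := hm t (by linarith)
    have h2 := hm (t - a - c * u t) (by linarith [hdelay t (by linarith)])
    calc |μ * u t + σ * u (t - a - c * u t)|
        ≤ |μ| * |u t| + |σ| * |u (t - a - c * u t)| := by
          rw [← abs_mul, ← abs_mul]; exact abs_add_le _ _
      _ ≤ |μ| * m + |σ| * m := by gcongr
      _ = (|μ| + |σ|) * m := by ring

/-- Variation of constants as a comparison inequality, going backwards from time `t`. -/
lemma backward_comparison {a c μ σ t α β : ℝ} {u G l : ℝ → ℝ} (hσ : σ < 0)
    (hu : ∀ t > 0, HasDerivAt u (μ * u t + σ * u (t - a - c * u t)) t) (hαβ : α ≤ β)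
    (hβ : β < t) (hG : ∀ w, HasDerivAt G (exp (μ * w) * l w) w)
    (hl : ∀ w ∈ Icc α β, l w ≤ u (t - w - a - c * u (t - w))) :
    u (t - α) * exp (μ * α) + σ * G α ≤ u (t - β) * exp (μ * β) + σ * G β := by
  have hd : ∀ w ∈ Icc α β, HasDerivAt (fun w => -(u (t - w) * exp (μ * w) + σ * G w))
      (σ * exp (μ * w) * (u (t - w - a - c * u (t - w)) - l w)) w := by
    intro w hw
    have h1 := (hu (t - w) (by linarith [hw.2])).comp_const_sub t w
    have h2 : HasDerivAt (fun w : ℝ => μ * w) μ w := by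
      simpa using (hasDerivAt_id w).const_mul μ
    refine (((h1.mul h2.exp).add ((hG w).const_mul σ)).fun_neg).congr_deriv ?_
    ring
  have := sub_le_mul_of_hasDerivAt_le (C := 0) hαβ hd (by
    intro w hw
    exact mul_nonpos_of_nonpos_of_nonneg
      (mul_nonpos_of_nonpos_of_nonneg hσ.le (exp_pos _).le) (sub_nonneg.2 (hl w hw)))
  linarith

/-- Primitive of `w ↦ exp (μ w) (-k - D w)`. -/
lemma hasDerivAt_exp_mul_affine {μ : ℝ} (hμ : μ ≠ 0) (k D w : ℝ) :
    HasDerivAt (fun w => exp (μ * w) * ((-k - D * w) / μ + D / μ ^ 2))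
      (exp (μ * w) * (-k - D * w)) w := by
  have h2 : HasDerivAt (fun w : ℝ => μ * w) μ w := by
    simpa using (hasDerivAt_id w).const_mul μ
  have h3 : HasDerivAt (fun w : ℝ => (-k - D * w) / μ + D / μ ^ 2) (-D / μ) w := by
    simpa using ((((hasDerivAt_id w).const_mul D).const_sub (-k)).div_const μ).add_const (D / μ ^ 2)
  refine (h2.exp.mul h3).congr_deriv ?_
  field_simp
  ring

lemma hasDerivAt_exp_mul_const {μ : ℝ} (hμ : μ ≠ 0) (x w : ℝ) :
    HasDerivAt (fun w => exp (μ * w) * (x / μ)) (exp (μ * w) * x) w := by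
  have h2 : HasDerivAt (fun w : ℝ => μ * w) μ w := by
    simpa using (hasDerivAt_id w).const_mul μ
  refine (h2.exp.mul_const (x / μ)).congr_deriv ?_
  field_simp

/-- Necessary condition on the value of a solution at a critical point. -/
lemma criticalGap_nonpos_of_critical {a c μ σ R T m x D t : ℝ} {u : ℝ → ℝ} (hμ : μ < 0)
    (hσ : σ < 0) (hu : ∀ t > 0, HasDerivAt u (μ * u t + σ * u (t - a - c * u t)) t)
    (hT : 0 ≤ T) (hR : 0 < R) (hm : ∀ t ≥ T, |u t| ≤ m)
    (hdelay : ∀ t ≥ T, a + c * u t ∈ Icc 0 R) (hx : ∀ t ≥ T, x ≤ u t)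
    (hD : D = (|μ| + |σ|) * (1 + (|μ| + |σ|) * m * |c|) * m) (hD0 : 0 < D)
    (ht : T + 3 * R ≤ t) (hcrit : μ * u t + σ * u (t - a - c * u t) = 0) :
    x + μ / σ * u t ≤ 0 ∧
      criticalGap (σ / μ) (D / -μ) (-x) (μ / σ * u t) (-μ * (a + c * u t)) ≤ 0 := by
  have hμ' := hμ.ne
  have hσ' := hσ.ne
  set k := μ / σ * u t with hk
  have hvk : u t = σ / μ * k := by rw [hk]; field_simp
  set r := a + c * u t with hr
  have hr0 : 0 ≤ r := (hdelay t (by linarith)).1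
  have hrR : r ≤ R := (hdelay t (by linarith)).2
  have hdel : u (t - r) = -k := by
    have : t - r = t - a - c * u t := by rw [hr]; ring
    rw [this, hk]
    field_simp
    linarith
  have hxk : x + k ≤ 0 := by
    have := hx (t - r) (by linarith)
    linarith
  refine ⟨hxk, ?_⟩
  have hm0 : 0 ≤ m := (abs_nonneg _).trans (hm T le_rfl)
  have harg : ∀ w ∈ Icc 0 r, T + R ≤ t - w - a - c * u (t - w) := by
    intro w hw
    have := (hdelay (t - w) (by linarith [hw.2])).2
    linarith [hw.2]
  have hlow : ∀ w ∈ Icc 0 r, x ≤ u (t - w - a - c * u (t - w)) :=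
    fun w hw => hx _ (by linarith [harg w hw])
  have hLip : ∀ w ∈ Icc 0 r, -k - D * w ≤ u (t - w - a - c * u (t - w)) := by
    intro w hw
    have h1 := abs_sub_le_of_delay_eq hu hT hR hm (fun t ht => (hdelay t ht).2)
      (by linarith : T + R ≤ t - r) (harg w hw)
    have h2 := abs_sub_le_of_delay_eq hu hT hR hm (fun t ht => (hdelay t ht).2)
      (by linarith : T + R ≤ t) (by linarith [hw.2] : T + R ≤ t - w)
    rw [hdel] at h1
    have h3 : |t - r - (t - w - a - c * u (t - w))| ≤ w + |c| * |u t - u (t - w)| := by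
      have : t - r - (t - w - a - c * u (t - w)) = w + -(c * (u t - u (t - w))) := by
        rw [hr]; ring
      rw [this, ← abs_mul, ← abs_neg (c * (u t - u (t - w)))]
      refine (abs_add_le _ _).trans ?_
      rw [abs_of_nonneg hw.1]
    have h4 : |t - (t - w)| = w := by rw [sub_sub_cancel, abs_of_nonneg hw.1]
    rw [h4] at h2
    have hL0 : 0 ≤ (|μ| + |σ|) * m := by positivity
    have h5 : |c| * |u t - u (t - w)| ≤ |c| * ((|μ| + |σ|) * m * w) := by gcongr
    have h6 := mul_le_mul_of_nonneg_left (h3.trans (add_le_add_right h5 w)) hL0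
    have h7 := le_abs_self (-k - u (t - w - a - c * u (t - w)))
    have h8 : (|μ| + |σ|) * m * (w + |c| * ((|μ| + |σ|) * m * w)) = D * w := by rw [hD]; ring
    linarith
  have hend : u (t - r) * exp (μ * r) = -k * exp (μ * r) := by rw [hdel]
  unfold criticalGap
  split_ifs with hbr
  · set w := (-x - k) / D with hw
    have hxw : x = -k - D * w := by rw [hw]; field_simp; ring
    have hw0 : 0 ≤ w := div_nonneg (by linarith) hD0.le
    have hwE : (-x - k) / (D / -μ) = -μ * w := by rw [hw]; field_simp
    rw [hwE] at hbr
    have hwr : w ≤ r := by nlinarith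
    have h1 := backward_comparison (t := t) hσ hu hw0 (by linarith)
      (hasDerivAt_exp_mul_affine hμ.ne k D) (fun y hy => hLip y ⟨hy.1, hy.2.trans hwr⟩)
    have h2 := backward_comparison (t := t) hσ hu hwr (by linarith)
      (hasDerivAt_exp_mul_const hμ.ne x) (fun y hy => hlow y ⟨hw0.trans hy.1, hy.2⟩)
    rw [hend] at h2
    unfold saturatedGap
    rw [hwE]
    simp only [neg_mul, neg_neg, mul_zero, exp_zero, sub_zero] at *
    have h3 := h1.trans_eq (show _ = (u (t - w) * exp (μ * w) + σ * (exp (μ * w) * (x / μ)))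
      + σ * (exp (μ * w) * (D / μ ^ 2)) by rw [hxw]; ring)
    have h4 := h3.trans (add_le_add_left h2 _)
    rw [hvk] at h4
    refine le_of_eq_of_le ?_ (sub_nonpos.2 h4)
    field_simp
    ring
  · have h1 := backward_comparison (t := t) hσ hu hr0 (by linarith)
      (hasDerivAt_exp_mul_affine hμ.ne k D) hLip
    rw [hend] at h1
    unfold lipschitzGap
    simp only [neg_mul, neg_neg, mul_zero, exp_zero, sub_zero] at *
    rw [hvk] at h1
    refine le_of_eq_of_le ?_ (sub_nonpos.2 h1)
    field_simp
    ring

lemma eventually_le_of_criticalGap_pos {a c μ σ R T m x D B : ℝ} {u : ℝ → ℝ} (hμ : μ < 0)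
    (hσ : σ < 0) (hcont : Continuous u)
    (hu : ∀ t > 0, HasDerivAt u (μ * u t + σ * u (t - a - c * u t)) t)
    (hT : 0 ≤ T) (hR : 0 < R) (hm : ∀ t ≥ T, |u t| ≤ m)
    (hdelay : ∀ t ≥ T, a + c * u t ∈ Icc 0 R) (hx : ∀ t ≥ T, x ≤ u t)
    (hD : D = (|μ| + |σ|) * (1 + (|μ| + |σ|) * m * |c|) * m) (hD0 : 0 < D) (hB : 0 < B)
    (hgap : ∀ v, B < v → 0 ≤ a + c * v →
      0 < criticalGap (σ / μ) (D / -μ) (-x) (μ / σ * v) (-μ * (a + c * v))) :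
    ∃ S ≥ T, ∀ t ≥ S, u t ≤ B := by
  obtain ⟨S, hS, hle⟩ := eventually_le_of_critical_le (T := T + 3 * R) (B := B) hμ hσ hcont hu
    (by linarith) hR (fun t ht => (hdelay t (by linarith)).2) hB (by
      intro t ht hcrit
      by_contra! hcon
      have h1 := (criticalGap_nonpos_of_critical hμ hσ hu hT hR hm hdelay hx hD hD0 ht hcrit).2
      have h2 := hgap (u t) hcon (hdelay t (by linarith)).1
      linarith)
  exact ⟨S, by linarith, hle⟩

lemma hasDerivWithinAt_Ici_of_delay_eq {a c μ σ : ℝ} {u : ℝ → ℝ} (hcont : Continuous u)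
    (hu : ∀ t > 0, HasDerivAt u (μ * u t + σ * u (t - a - c * u t)) t) {t : ℝ} (ht : 0 ≤ t) :
    HasDerivWithinAt u (μ * u t + σ * u (t - a - c * u t)) (Ici t) t := by
  refine hasDerivWithinAt_Ici_of_tendsto_deriv (s := Ioi t)
    (fun s hs => (hu s (ht.trans_lt hs)).differentiableAt.differentiableWithinAt)
    hcont.continuousWithinAt self_mem_nhdsWithin ?_
  have hg : Continuous fun t => μ * u t + σ * u (t - a - c * u t) := by fun_prop
  refine (hg.continuousWithinAt (s := Ioi t) (x := t)).tendsto.congr' ?_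
  filter_upwards [self_mem_nhdsWithin] with s hs
  exact (hu s (ht.trans_lt hs)).deriv.symm

/-- A level is a barrier if the vector field is nonpositive whenever `u` touches a line of small
slope issuing from it. -/
lemma le_of_barrier {a c μ σ T B δ₀ : ℝ} {u : ℝ → ℝ} (hcont : Continuous u)
    (hu : ∀ t > 0, HasDerivAt u (μ * u t + σ * u (t - a - c * u t)) t) (hT : 0 ≤ T)
    (hδ₀ : 0 < δ₀) (hB : u T ≤ B)
    (h : ∀ δ, 0 < δ → δ ≤ δ₀ → ∀ t ≥ T, u t = B + δ * (t - T) →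
      μ * u t + σ * u (t - a - c * u t) ≤ 0) : ∀ t ≥ T, u t ≤ B := by
  intro t ht
  have key : ∀ δ, 0 < δ → δ ≤ δ₀ → u t ≤ B + δ * (t - T) := by
    intro δ hδ hδ'
    refine image_le_of_deriv_right_lt_deriv_boundary (f := u) (a := T) (b := t)
      (f' := fun t => μ * u t + σ * u (t - a - c * u t)) (B := fun t => B + δ * (t - T))
      (B' := fun _ => δ) hcont.continuousOn
      (fun s hs => hasDerivWithinAt_Ici_of_delay_eq hcont hu (hT.trans hs.1)) (by simpa using hB)
      (fun s => ?_) (fun s hs he => ?_) (right_mem_Icc.2 ht)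
    · simpa using (((hasDerivAt_id s).sub_const T).const_mul δ).const_add B
    · exact (h δ hδ hδ' s hs.1 he).trans_lt hδ
  by_contra! hcon
  have h1 : 0 < t - T := by
    rcases (ge_iff_le.1 ht).eq_or_lt with rfl | h
    · linarith
    · linarith
  set δ := min δ₀ ((u t - B) / (2 * (t - T)))
  have hδ : 0 < δ := lt_min hδ₀ (div_pos (by linarith) (by linarith))
  have h2 := key δ hδ (min_le_left _ _)
  have h3 : δ * (t - T) ≤ (u t - B) / (2 * (t - T)) * (t - T) :=
    mul_le_mul_of_nonneg_right (min_le_right _ _) h1.le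
  have h4 : (u t - B) / (2 * (t - T)) * (t - T) = (u t - B) / 2 := by field_simp
  linarith

lemma criticalGap_smul {κ : ℝ} (hκ : 0 < κ) (p E X z ρ : ℝ) :
    criticalGap p (κ * E) (κ * X) (κ * z) ρ = κ * criticalGap p E X z ρ := by
  unfold criticalGap saturatedGap lipschitzGap
  have : (κ * X - κ * z) / (κ * E) = (X - z) / E := by
    rw [← mul_sub, mul_div_mul_left _ _ hκ.ne']
  rw [this]
  split_ifs <;> ring

lemma Qtwo_eq_criticalGap {a c μ σ x y : ℝ} (hμ : μ < 0) (hσ : σ < 0)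
    (hxy : x < y) (hD : 0 < Dfun c μ σ x y) (v : ℝ) :
    Qtwo a c μ σ v x y =
      criticalGap (σ / μ) (Dfun c μ σ x y / -μ) (-x) (μ / σ * v) (-μ * (a + c * v)) := by
  unfold Qtwo criticalGap saturatedGap lipschitzGap
  rw [Real.sign_of_pos (sub_pos.2 hxy)]
  set D := Dfun c μ σ x y
  have hμ' := hμ.ne
  have hσ' := hσ.ne
  have he : (-x - μ / σ * v) / (D / -μ) = -μ * (-1 * (x + μ / σ * v) / D) := by
    field_simp; ring
  have he2 : -μ * 1 * (x + μ / σ * v) / D = -(-μ * (-1 * (x + μ / σ * v) / D)) := by ring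
  have he3 : -(-μ * (a + c * v)) = μ * (a + c * v) := by ring
  simp only [he, he2, he3, mul_lt_mul_iff_right₀ (neg_pos.2 hμ)]
  split_ifs
  · field_simp; ring
  · field_simp; ring

lemma Qtwo_eq_neg_criticalGap {a c μ σ x y : ℝ} (hμ : μ < 0) (hσ : σ < 0)
    (hxy : y < x) (hD : 0 < Dfun c μ σ x y) (v : ℝ) :
    Qtwo a c μ σ v x y =
      -criticalGap (σ / μ) (Dfun c μ σ x y / -μ) x (μ / σ * -v) (-μ * (a + c * v)) := by
  unfold Qtwo criticalGap saturatedGap lipschitzGap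
  rw [Real.sign_of_neg (sub_neg.2 hxy)]
  set D := Dfun c μ σ x y
  have hμ' := hμ.ne
  have hσ' := hσ.ne
  have he : (x - μ / σ * -v) / (D / -μ) = -μ * (-(-1) * (x + μ / σ * v) / D) := by
    field_simp; ring
  have he2 : -μ * -1 * (x + μ / σ * v) / D = -(-μ * (-(-1) * (x + μ / σ * v) / D)) := by ring
  have he3 : -(-μ * (a + c * v)) = μ * (a + c * v) := by ring
  simp only [he, he2, he3, mul_lt_mul_iff_right₀ (neg_pos.2 hμ)]
  split_ifs
  · field_simp; ring
  · field_simp; ring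

lemma Dfun_pos {c μ σ x y : ℝ} (hc : 0 < c) (hμ : μ < 0) (hx : x ≠ 0) : 0 < Dfun c μ σ x y := by
  unfold Dfun
  have h1 : 0 < |μ| := abs_pos.2 hμ.ne
  have h2 : 0 < max |x| |y| := lt_max_of_lt_left (abs_pos.2 hx)
  positivity

lemma Dfun_comm (c μ σ x y : ℝ) : Dfun c μ σ x y = Dfun c μ σ y x := by
  unfold Dfun; rw [max_comm]

lemma one_le_div_of_le_of_neg {μ σ : ℝ} (hσμ : σ ≤ μ) (hμ : μ < 0) : 1 ≤ σ / μ := by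
  rw [one_le_div_of_neg hμ]; exact hσμ

lemma Dfun_lower_bound {c μ σ x y : ℝ} (hc : 0 < c) (hσμ : σ ≤ μ) (hμ : μ < 0) (hx : x < 0) :
    (1 + σ / μ) * (1 + (1 + σ / μ) * (-μ * c * -x)) * (-μ * c * -x) ≤
      -μ * c * (Dfun c μ σ x y / -μ) := by
  have hp := one_le_div_of_le_of_neg hσμ hμ
  have hm : -x ≤ max |x| |y| := (neg_le_abs x).trans (le_max_left _ _)
  have hsum : |μ| + |σ| = -μ * (1 + σ / μ) := by
    rw [abs_of_neg hμ, abs_of_neg (hσμ.trans_lt hμ)]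
    field_simp [hμ.ne]
    ring
  have hκ : 0 < -μ * c := mul_pos (by linarith) hc
  unfold Dfun
  rw [hsum]
  set m := max |x| |y|
  set p := σ / μ
  have : -μ * c * (-μ * (1 + p) * (1 + -μ * (1 + p) * m * c) * m / -μ)
      = (1 + p) * (1 + (1 + p) * (-μ * c * m)) * (-μ * c * m) := by
    field_simp [hμ.ne]
  rw [this]
  have hle : -μ * c * -x ≤ -μ * c * m := mul_le_mul_of_nonneg_left hm hκ.le
  have h0 : 0 < -μ * c * -x := mul_pos hκ (by linarith)
  gcongr

/-- Beyond a zero in the upper range the critical gap is positive. -/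
lemma criticalGap_pos_of_Qtwo_upper_zero {a c μ σ x y v₀ v : ℝ} (hc : 0 < c)
    (hσμ : σ ≤ μ) (hμ : μ < 0) (hx : x < 0) (hxa : -a ≤ c * x) (hy : 0 < y) (hv₀ : 0 ≤ v₀)
    (hv : v₀ < v) (h0 : Qtwo a c μ σ v₀ x y = 0) :
    0 < criticalGap (σ / μ) (Dfun c μ σ x y / -μ) (-x) (μ / σ * v) (-μ * (a + c * v)) := by
  have hσ : σ < 0 := hσμ.trans_lt hμ
  have hμ' := hμ.ne
  have hσ' := hσ.ne
  have hκ : 0 < -μ * c := mul_pos (by linarith) hc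
  have hp := one_le_div_of_le_of_neg hσμ hμ
  have hd : 0 < μ / σ := div_pos_of_neg_of_neg hμ hσ
  have hρ : ∀ v, -μ * (a + c * v) = -μ * a + σ / μ * (-μ * c * (μ / σ * v)) := by
    intro v; field_simp; ring
  rw [Qtwo_eq_criticalGap hμ hσ (by linarith) (Dfun_pos hc hμ hx.ne)] at h0
  refine (mul_pos_iff_of_pos_left hκ).1 ?_
  rw [← criticalGap_smul hκ, hρ]
  refine criticalGap_pos_of_increasing_delay (z₀ := -μ * c * (μ / σ * v₀)) hp
    (mul_pos hκ (by linarith)) (by nlinarith) (Dfun_lower_bound hc hσμ hμ hx) (by positivity)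
    (mul_lt_mul_of_pos_left (mul_lt_mul_of_pos_left hv hd) hκ) ?_
  rw [← hρ, criticalGap_smul hκ, h0, mul_zero]

/-- Beyond a zero in the lower range the reflected critical gap is positive. -/
lemma criticalGap_pos_of_Qtwo_lower_zero {a c μ σ x y v₀ v : ℝ} (hc : 0 < c)
    (hσμ : σ ≤ μ) (hμ : μ < 0) (hx : 0 < x) (hy : y < 0) (hv₀ : v₀ ≤ 0)
    (hv : v < v₀) (hva : 0 ≤ a + c * v) (h0 : Qtwo a c μ σ v₀ x y = 0) :
    0 < criticalGap (σ / μ) (Dfun c μ σ x y / -μ) x (μ / σ * -v) (-μ * (a + c * v)) := by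
  have hσ : σ < 0 := hσμ.trans_lt hμ
  have hμ' := hμ.ne
  have hσ' := hσ.ne
  have hκ : 0 < -μ * c := mul_pos (by linarith) hc
  have hp := one_le_div_of_le_of_neg hσμ hμ
  have hd : 0 < μ / σ := div_pos_of_neg_of_neg hμ hσ
  have hD := Dfun_pos (σ := σ) (y := y) hc hμ hx.ne'
  have hρ : ∀ v, -μ * (a + c * v) = -μ * a + -(σ / μ) * (-μ * c * (μ / σ * -v)) := by
    intro v; field_simp; ring
  rw [Qtwo_eq_neg_criticalGap hμ hσ (by linarith) hD, neg_eq_zero] at h0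
  refine (mul_pos_iff_of_pos_left hκ).1 ?_
  rw [← criticalGap_smul hκ, hρ]
  refine criticalGap_pos_of_decreasing_delay (z₀ := -μ * c * (μ / σ * -v₀)) hp
    (mul_pos hκ (div_pos hD (by linarith))) (mul_pos hκ hx)
    (mul_nonneg hκ.le (mul_nonneg hd.le (by linarith)))
    (mul_lt_mul_of_pos_left (mul_lt_mul_of_pos_left (by linarith) hd) hκ) ?_ ?_
  · have := hρ v
    have h2 : 0 ≤ -μ * (a + c * v) := mul_nonneg (by linarith) hva
    linarith
  · rw [← hρ, criticalGap_smul hκ, h0, mul_zero]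

lemma Qtwo_zero_ne_zero_upper {a c μ σ x y : ℝ} (ha : 0 < a) (hc : 0 < c) (hσμ : σ ≤ μ)
    (hμ : μ < 0) (hx : x < 0) (hy : 0 < y) : Qtwo a c μ σ 0 x y ≠ 0 := by
  have hD := Dfun_pos (σ := σ) (y := y) hc hμ hx.ne
  rw [Qtwo_eq_criticalGap hμ (hσμ.trans_lt hμ) (by linarith) hD, mul_zero, mul_zero, add_zero]
  exact (criticalGap_zero_neg (one_le_div_of_le_of_neg hσμ hμ) (div_pos hD (by linarith))
    (by linarith) (mul_pos (by linarith) ha)).ne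

lemma Qtwo_zero_ne_zero_lower {a c μ σ x y : ℝ} (ha : 0 < a) (hc : 0 < c) (hσμ : σ ≤ μ)
    (hμ : μ < 0) (hx : 0 < x) (hy : y < 0) : Qtwo a c μ σ 0 x y ≠ 0 := by
  have hD := Dfun_pos (σ := σ) (y := y) hc hμ hx.ne'
  rw [Qtwo_eq_neg_criticalGap hμ (hσμ.trans_lt hμ) (by linarith) hD, neg_zero, mul_zero, mul_zero,
    add_zero]
  exact neg_ne_zero.2 (criticalGap_zero_neg (one_le_div_of_le_of_neg hσμ hμ)
    (div_pos hD (by linarith)) hx (mul_pos (by linarith) ha)).ne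

lemma hasDerivAt_neg_of_delay_eq {a c μ σ : ℝ} {u : ℝ → ℝ}
    (hu : ∀ t > 0, HasDerivAt u (μ * u t + σ * u (t - a - c * u t)) t) :
    ∀ t > 0, HasDerivAt (fun t => -u t)
      (μ * -u t + σ * -u (t - a - -c * -u t)) t := by
  intro t ht
  refine (hu t ht).fun_neg.congr_deriv ?_
  rw [neg_mul_neg]; ring

/-- One step of the recursion. -/
lemma eventually_mem_Icc_step {a c μ σ R T M N M' N' : ℝ} {u : ℝ → ℝ} (hc : 0 < c)
    (hσμ : σ ≤ μ) (hμ : μ < 0) (hcont : Continuous u)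
    (hu : ∀ t > 0, HasDerivAt u (μ * u t + σ * u (t - a - c * u t)) t) (hT : 0 ≤ T) (hR : 0 < R)
    (hdelay : ∀ t ≥ T, a + c * u t ∈ Icc 0 R) (hmem : ∀ t ≥ T, u t ∈ Icc M N)
    (hM : M < 0) (hMa : -a ≤ c * M) (hN : 0 < N) (hM' : M' < 0) (hN' : 0 < N')
    (hQM : Qtwo a c μ σ M' N M = 0) (hQN : Qtwo a c μ σ N' M N = 0) :
    ∃ S ≥ T, ∀ t ≥ S, u t ∈ Icc M' N' := by
  have hσ : σ < 0 := hσμ.trans_lt hμ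
  have hm : ∀ t ≥ T, |u t| ≤ max |M| |N| := fun t ht =>
    abs_le_max_abs_abs (hmem t ht).1 (hmem t ht).2
  obtain ⟨S₁, hS₁, h₁⟩ := eventually_le_of_criticalGap_pos (D := Dfun c μ σ M N) (B := N')
    hμ hσ hcont hu hT hR hm hdelay (fun t ht => (hmem t ht).1)
    (by rw [abs_of_pos hc]; rfl) (Dfun_pos hc hμ hM.ne) hN'
    (fun v hv _ => criticalGap_pos_of_Qtwo_upper_zero hc hσμ hμ hM hMa hN hN'.le hv hQN)
  obtain ⟨S₂, hS₂, h₂⟩ := eventually_le_of_criticalGap_pos (a := a) (c := -c) (x := -N)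
    (u := fun t => -u t) (D := Dfun c μ σ N M) (B := -M')
    hμ hσ hcont.neg (hasDerivAt_neg_of_delay_eq hu) hT hR (fun t ht => (abs_neg (u t)).trans_le (hm t ht))
    (fun t ht => by simpa using hdelay t ht)
    (fun t ht => by simpa using (hmem t ht).2)
    (by rw [abs_neg, abs_of_pos hc, Dfun_comm]; rfl) (Dfun_pos hc hμ hN.ne') (by linarith)
    (fun v hv hva => by
      have := criticalGap_pos_of_Qtwo_lower_zero (v := -v) hc hσμ hμ hN hM hM'.le (by linarith)
        (by linarith) hQM
      simpa using this)
  refine ⟨max S₁ S₂, hS₁.trans (le_max_left _ _), fun t ht => ⟨?_, ?_⟩⟩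
  · have := h₂ t ((le_max_right _ _).trans ht)
    linarith
  · exact h₁ t ((le_max_left _ _).trans ht)

/-- Every solution with history above `-a/c` eventually enters `[-a/c, aσ/(cμ)]`. -/
lemma eventually_mem_Icc_Mzero_Nzero {a c μ σ N τ : ℝ} {φ u : ℝ → ℝ} (ha : 0 < a) (hc : 0 < c)
    (hσμ : σ ≤ μ) (hμ : μ < 0) (hN : N = max (Nzero a c μ σ) (φ 0)) (hτ : τ = a + c * N)
    (hφ : ∀ t ∈ Icc (-τ) (0 : ℝ), Mzero a c ≤ φ t) (hsol : IsSDDESolution a c μ σ φ u) :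
    ∃ T ≥ (0 : ℝ), ∀ t ≥ T, u t ∈ Icc (Mzero a c) (Nzero a c μ σ) := by
  obtain ⟨hcont, hhist, -, hu⟩ := hsol
  have hσ : σ < 0 := hσμ.trans_lt hμ
  have hμ' := hμ.ne
  have hcM : c * Mzero a c = -a := by unfold Mzero; field_simp
  have hM0 : Mzero a c < 0 := by unfold Mzero; exact div_neg_of_neg_of_pos (by linarith) hc
  have hμN : μ * Nzero a c μ σ + σ * Mzero a c = 0 := by
    unfold Mzero Nzero; field_simp; ring
  have hN0 : 0 < Nzero a c μ σ := by
    unfold Nzero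
    exact div_pos_of_neg_of_neg (mul_neg_of_pos_of_neg ha hσ) (mul_neg_of_pos_of_neg hc hμ)
  have hNN : Nzero a c μ σ ≤ N := hN ▸ le_max_left _ _
  have hτ0 : 0 < τ := by rw [hτ]; have := mul_pos hc (hN0.trans_le hNN); linarith
  have hu0 : u 0 = φ 0 := hhist 0 le_rfl
  have hlow0 : ∀ t ≥ 0, Mzero a c ≤ u t := by
    intro t ht
    have := image_le_of_deriv_right_lt_deriv_boundary (f := fun t => -u t) (a := 0) (b := t)
      (f' := fun t => -(μ * u t + σ * u (t - a - c * u t))) (B := fun _ => -Mzero a c)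
      (B' := fun _ => 0) hcont.neg.continuousOn
      (fun s hs => (hasDerivWithinAt_Ici_of_delay_eq hcont hu hs.1).fun_neg)
      (neg_le_neg (hu0 ▸ hφ 0 ⟨by linarith, le_rfl⟩))
      (fun s => hasDerivAt_const _ _) (fun s hs he => ?_) (right_mem_Icc.2 ht)
    · simpa using this
    · have he : u s = Mzero a c := neg_injective he
      have h1 : s - a - c * u s = s := by rw [he, hcM]; ring
      rw [h1, he]
      nlinarith
  have hlow : ∀ t ≥ -τ, Mzero a c ≤ u t := by
    intro t ht
    rcases le_total 0 t with h | h
    · exact hlow0 t h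
    · rw [hhist t h]; exact hφ t ⟨ht, h⟩
  have hfield : ∀ t, Nzero a c μ σ ≤ u t → -τ ≤ t - a - c * u t →
      μ * u t + σ * u (t - a - c * u t) ≤ 0 := by
    intro t h1 h2
    have h3 := hlow _ h2
    nlinarith
  have hup : ∀ t ≥ 0, u t ≤ N := by
    refine le_of_barrier (δ₀ := 1 / c) hcont hu le_rfl (by positivity)
      (by rw [hu0, hN]; exact le_max_right _ _) (fun δ hδ hδ' t ht he => hfield t ?_ ?_)
    · have : 0 ≤ δ * (t - 0) := mul_nonneg hδ.le (by linarith)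
      linarith
    · rw [le_div_iff₀ hc] at hδ'
      rw [he, hτ]
      nlinarith
  have hdelay : ∀ t ≥ 0, a + c * u t ≤ τ := by
    intro t ht
    have := mul_le_mul_of_nonneg_left (hup t ht) hc.le
    linarith
  obtain ⟨T, hT, huT⟩ := exists_le_of_delay_eq hμ hσ hu le_rfl hτ0 hdelay hN0
  refine ⟨T, hT, fun t ht => ⟨hlow0 t (hT.trans ht), ?_⟩⟩
  refine le_of_barrier hcont hu hT one_pos huT (fun δ hδ _ s hs he => hfield s ?_ ?_) t ht
  · have : 0 ≤ δ * (s - T) := mul_nonneg hδ.le (by linarith)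
    linarith
  · have := hdelay s (hT.trans hs)
    linarith [hT.trans hs]

/-- Recursive shrinking bounds on solutions, second-order version. -/
theorem sdde_shrinking_bounds_Q2
    (a c μ σ N τ : ℝ) (φ u : ℝ → ℝ) (Ms Ns : ℕ → ℝ)
    (ha : 0 < a) (hc : 0 < c) (hσμ : σ ≤ μ) (hμ : μ < 0)
    (hN : N = max (Nzero a c μ σ) (φ 0)) (hτ : τ = a + c * N)
    (hφcont : Continuous φ)
    (hφ : ∀ t ∈ Set.Icc (-τ) (0:ℝ), Mzero a c ≤ φ t)
    (hu : IsSDDESolution a c μ σ φ u)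
    (hM0 : Ms 0 = Mzero a c) (hN0 : Ns 0 = Nzero a c μ σ)
    (hrecM : ∀ n, Ms (n + 1) ∈ Set.Icc (Mzero a c) (0:ℝ) ∧
      Qtwo a c μ σ (Ms (n + 1)) (Ns n) (Ms n) = 0)
    (hrecN : ∀ n, Ns (n + 1) ∈ Set.Icc (0:ℝ) (Nzero a c μ σ) ∧
      Qtwo a c μ σ (Ns (n + 1)) (Ms n) (Ns n) = 0) :
    ∀ n : ℕ, ∃ T ≥ (0:ℝ), ∀ t ≥ T, u t ∈ Set.Icc (Ms n) (Ns n) := by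
  obtain ⟨T₀, hT₀, hbase⟩ := eventually_mem_Icc_Mzero_Nzero ha hc hσμ hμ hN hτ hφ hu
  obtain ⟨hcont, -, -, hderiv⟩ := hu
  have hσ : σ < 0 := hσμ.trans_lt hμ
  have hcM : c * Mzero a c = -a := by unfold Mzero; field_simp
  have hMneg : Mzero a c < 0 := by unfold Mzero; exact div_neg_of_neg_of_pos (by linarith) hc
  have hNpos : 0 < Nzero a c μ σ := by
    unfold Nzero
    exact div_pos_of_neg_of_neg (mul_neg_of_pos_of_neg ha hσ) (mul_neg_of_pos_of_neg hc hμ)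
  have hR : 0 < a + c * Nzero a c μ σ := by positivity
  have hdelay : ∀ t ≥ T₀, a + c * u t ∈ Icc 0 (a + c * Nzero a c μ σ) := by
    intro t ht
    have h1 := mul_le_mul_of_nonneg_left (hbase t ht).1 hc.le
    have h2 := mul_le_mul_of_nonneg_left (hbase t ht).2 hc.le
    exact ⟨by linarith, by linarith⟩
  have hlow : ∀ n, -a ≤ c * Ms n := by
    intro n
    rw [← hcM]
    refine mul_le_mul_of_nonneg_left ?_ hc.le
    cases n with
    | zero => exact hM0.ge
    | succ n => exact (hrecM n).1.1
  have hsign : ∀ n, Ms n < 0 ∧ 0 < Ns n := by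
    intro n
    induction n with
    | zero => exact ⟨hM0 ▸ hMneg, hN0 ▸ hNpos⟩
    | succ n ih =>
      refine ⟨lt_of_le_of_ne (hrecM n).1.2 fun h => ?_, lt_of_le_of_ne (hrecN n).1.1 fun h => ?_⟩
      · exact Qtwo_zero_ne_zero_lower ha hc hσμ hμ ih.2 ih.1 (h ▸ (hrecM n).2)
      · exact Qtwo_zero_ne_zero_upper ha hc hσμ hμ ih.1 ih.2 (h ▸ (hrecN n).2)
  suffices h : ∀ n, ∃ T ≥ T₀, ∀ t ≥ T, u t ∈ Icc (Ms n) (Ns n) by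
    intro n
    obtain ⟨T, hT, hmem⟩ := h n
    exact ⟨T, hT₀.trans hT, hmem⟩
  intro n
  induction n with
  | zero => exact ⟨T₀, le_rfl, by rwa [hM0, hN0]⟩
  | succ n ih =>
    obtain ⟨T, hT, hmem⟩ := ih
    obtain ⟨S, hS, hmem'⟩ := eventually_mem_Icc_step hc hσμ hμ hcont hderiv (hT₀.trans hT) hR
      (fun t ht => hdelay t (hT.trans ht)) hmem (hsign n).1 (hlow n) (hsign n).2
      (hsign (n + 1)).1 (hsign (n + 1)).2 (hrecM n).2 (hrecN n).2
    exact ⟨S, hT.trans hS, hmem'⟩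
end

section
/- (Global asymptotic stability criterion, first-order version.) Let a > 0, c > 0 and σ ≤ μ < 0. Set N = max{N₀, φ(0)} and τ = a + c·N, and suppose φ is continuous with φ(t) ≥ M₀ for all t ∈ [−τ, 0]. Suppose that the only pair (M, N') ∈ [M₀, 0] × [0, N₀] satisfying Q₁(N', M) = 0 and Q₁(M, N') = 0 is M = N' = 0. Then every solution u of the SDDE satisfies u(t) → 0 as t → ∞. -/
open Real Set Filter

/-- If `u` exceeds `S - ε` at arbitrarily late times, then at some arbitrarily late such time the
derivative of `u` is at least `-ε`. -/
lemma exists_late_almost_max_deriv_ge {u u' : ℝ → ℝ} {S ε T : ℝ} (hT : 0 < T) (hε : 0 < ε)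
    (hd : ∀ t > 0, HasDerivAt u (u' t) t)
    (hS : ∃ᶠ t in atTop, S - ε < u t) :
    ∃ t ≥ T, S - ε ≤ u t ∧ -ε ≤ u' t := by
  by_contra! hcon
  by_cases hstay : ∀ t ≥ T, S - ε ≤ u t
  · have hle : ∀ t ≥ T, u t ≤ u T - ε * (t - T) := fun t ht =>
      image_le_of_deriv_right_lt_deriv_boundary (f := u) (f' := u') (a := T) (b := t)
        (B := fun s => u T - ε * (s - T)) (B' := fun _ => -ε)
        (fun s hs => (hd s (hT.trans_le hs.1)).continuousAt.continuousWithinAt)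
        (fun s hs => (hd s (hT.trans_le hs.1)).hasDerivWithinAt)
        (by simp)
        (fun s => by
          have := ((hasDerivAt_id s).sub_const T).const_mul ε |>.const_sub (u T)
          simpa using this)
        (fun s hs _ => hcon s hs.1 (hstay s hs.1))
        ⟨ht, le_rfl⟩
    have hgap : 0 ≤ (u T - (S - ε)) / ε := div_nonneg (sub_nonneg.2 (hstay T le_rfl)) hε.le
    have hge : T + (u T - (S - ε)) / ε + 1 ≥ T := by linarith
    have h1 := hle _ hge
    have h2 := hstay _ hge
    have h3 : ε * (T + (u T - (S - ε)) / ε + 1 - T) = u T - (S - ε) + ε := by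
      field_simp
      ring
    linarith
  · push Not at hstay
    obtain ⟨p, hp, hup⟩ := hstay
    obtain ⟨t, ht, hut⟩ := (frequently_atTop.1 hS) p
    have : u t ≤ S - ε :=
      image_le_of_deriv_right_lt_deriv_boundary (f := u) (f' := u') (a := p) (b := t)
        (B := fun _ => S - ε) (B' := fun _ => 0)
        (fun s hs => (hd s (hT.trans_le (hp.trans hs.1))).continuousAt.continuousWithinAt)
        (fun s hs => (hd s (hT.trans_le (hp.trans hs.1))).hasDerivWithinAt)
        hup.le
        (fun s => hasDerivAt_const s _)
        (fun s hs h => by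
          have := hcon s (hp.trans hs.1) h.ge
          linarith)
        ⟨ht, le_rfl⟩
    linarith

/-- Integrated form of the differential inequality `u' ≤ μ u + k`. -/
lemma add_div_le_exp_mul_of_deriv_le_s18 {u u' : ℝ → ℝ} {μ k d t : ℝ} (hμ : μ ≠ 0) (hdt : d ≤ t)
    (hd : ∀ s ∈ Icc d t, HasDerivAt u (u' s) s)
    (hle : ∀ s ∈ Icc d t, u' s ≤ μ * u s + k) :
    u t + k / μ ≤ Real.exp (μ * (t - d)) * (u d + k / μ) := by
  have hder : ∀ s ∈ Icc d t, HasDerivAt (fun s => Real.exp (-μ * s) * (u s + k / μ))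
      (Real.exp (-μ * s) * (u' s - (μ * u s + k))) s := by
    intro s hs
    have h1 : HasDerivAt (fun s => Real.exp (-μ * s)) (Real.exp (-μ * s) * -μ) s := by
      simpa using ((hasDerivAt_id s).const_mul (-μ)).exp
    refine (h1.fun_mul ((hd s hs).add_const (k / μ))).congr_deriv ?_
    have hk : k = μ * (k / μ) := (mul_div_cancel₀ k hμ).symm
    linear_combination Real.exp (-μ * s) * hk
  have hanti : AntitoneOn (fun s => Real.exp (-μ * s) * (u s + k / μ)) (Icc d t) :=
    antitoneOn_of_hasDerivWithinAt_nonpos (convex_Icc d t)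
      (fun s hs => (hder s hs).continuousAt.continuousWithinAt)
      (fun s hs => (hder s (interior_subset hs)).hasDerivWithinAt)
      (fun s hs => mul_nonpos_of_nonneg_of_nonpos (Real.exp_pos _).le
        (sub_nonpos.2 (hle s (interior_subset hs))))
  have h := hanti (left_mem_Icc.2 hdt) (right_mem_Icc.2 hdt) hdt
  have h2 := mul_le_mul_of_nonneg_left h (Real.exp_pos (μ * t)).le
  simp only [← mul_assoc, ← Real.exp_add] at h2
  rwa [show μ * t + -μ * t = 0 by ring, Real.exp_zero, one_mul,
    show μ * t + -μ * d = μ * (t - d) by ring] at h2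

lemma continuous_Qone (a c μ σ : ℝ) : Continuous fun p : ℝ × ℝ => Qone a c μ σ p.1 p.2 := by
  unfold Qone
  fun_prop

lemma Qone_neg (a c μ σ v x : ℝ) : Qone a (-c) μ σ (-v) (-x) = -Qone a c μ σ v x := by
  simp only [Qone, neg_mul_neg]
  ring

/-- If `S` is the upper limit and `L` a lower bound for the lower limit of a bounded solution whose
delay stays nonnegative, then `Q₁(S, L) ≤ 0`. The sign of `c` is arbitrary. -/
lemma Qone_upper_lower_nonpos {a c μ σ K S L : ℝ} {u : ℝ → ℝ} (hμ : μ < 0) (hσ : σ < 0)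
    (hd : ∀ t > 0, HasDerivAt u (μ * u t + σ * u (t - a - c * u t)) t)
    (hK : ∀ t ≥ 0, |u t| ≤ K) (hdelay : ∀ t ≥ 0, 0 ≤ a + c * u t)
    (hS : ∀ ε > 0, ∃ᶠ t in atTop, S - ε < u t)
    (hS' : ∀ ε > 0, ∀ᶠ t in atTop, u t < S + ε)
    (hL : ∀ ε > 0, ∀ᶠ t in atTop, L - ε < u t) :
    Qone a c μ σ S L ≤ 0 := by
  have key : ∀ ε > 0, ∃ x, S - ε ≤ x ∧ x ≤ S + ε ∧ Qone a c μ σ x (L - ε) ≤ -ε / σ := by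
    intro ε hε
    obtain ⟨T₀, hT₀⟩ := eventually_atTop.1 ((hS' ε hε).and (hL ε hε))
    set T := max T₀ 1 with hTdef
    have hT1 : 1 ≤ T := le_max_right _ _
    have hT : ∀ t ≥ T, u t < S + ε ∧ L - ε < u t := fun t ht => hT₀ t ((le_max_left _ _).trans ht)
    set R := |a| + |c| * K with hR
    have hRd : ∀ t ≥ 0, a + c * u t ≤ R := by
      intro t ht
      have h1 : c * u t ≤ |c| * K := (le_abs_self _).trans
        ((abs_mul c (u t)).trans_le (mul_le_mul_of_nonneg_left (hK t ht) (abs_nonneg c)))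
      linarith [le_abs_self a]
    have hR0 : 0 ≤ R := (hdelay 0 le_rfl).trans (hRd 0 le_rfl)
    obtain ⟨t, ht, hut, hut'⟩ := exists_late_almost_max_deriv_ge (T := T + 2 * R) (by linarith) hε hd
      (hS ε hε)
    have ht0 : 0 ≤ t := by linarith
    have hr0 := hdelay t ht0
    have hrR := hRd t ht0
    refine ⟨u t, hut, (hT t (by linarith)).1.le, ?_⟩
    have hcmp := add_div_le_exp_mul_of_deriv_le_s18 (u := u) (k := σ * (L - ε)) hμ.ne
      (show t - a - c * u t ≤ t by linarith)
      (fun s hs => hd s (by linarith [hs.1]))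
      (fun s hs => by
        have hs0 : 0 ≤ s := by linarith [hs.1]
        have h1 := (hT (s - a - c * u s) (by linarith [hRd s hs0, hs.1])).2
        have := mul_le_mul_of_nonpos_left h1.le hσ.le
        linarith)
    rw [show t - (t - a - c * u t) = a + c * u t by ring] at hcmp
    set E := Real.exp (μ * (a + c * u t)) with hE
    have hEpos : 0 < E := Real.exp_pos _
    have hE1 : E ≤ 1 := Real.exp_le_one_iff.2 (mul_nonpos_of_nonpos_of_nonneg hμ.le hr0)
    have hud : u (t - a - c * u t) ≤ -(μ / σ) * u t + -ε / σ := by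
      have : -(μ / σ) * u t + -ε / σ = (-ε - μ * u t) / σ := by ring
      rw [this, le_div_iff_of_neg hσ]
      linarith
    have h1 := mul_le_mul_of_nonneg_left hud hEpos.le
    have h2 : E * (-ε / σ) ≤ -ε / σ := by
      have : 0 ≤ -ε / σ := div_nonneg_of_nonpos (by linarith) hσ.le
      nlinarith
    simp only [Qone]
    rw [← hE]
    rw [mul_div_right_comm] at hcmp
    nlinarith
  choose! x hx using key
  let ε : ℕ → ℝ := fun n => 1 / ((n : ℝ) + 1)
  have hε : Tendsto ε atTop (nhds 0) := tendsto_one_div_add_atTop_nhds_zero_nat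
  have hεpos : ∀ n, 0 < ε n := fun n => Nat.one_div_pos_of_nat
  have hxS : Tendsto (fun n => x (ε n)) atTop (nhds S) :=
    tendsto_of_tendsto_of_tendsto_of_le_of_le
      (by simpa using tendsto_const_nhds.sub hε) (by simpa using tendsto_const_nhds.add hε)
      (fun n => (hx _ (hεpos n)).1) (fun n => (hx _ (hεpos n)).2.1)
  have hLε : Tendsto (fun n => L - ε n) atTop (nhds L) := by
    simpa using tendsto_const_nhds.sub hε
  have hQ := ((continuous_Qone a c μ σ).tendsto (S, L)).comp (hxS.prodMk_nhds hLε)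
  have hbd : Tendsto (fun n => -ε n / σ) atTop (nhds 0) := by
    simpa using hε.neg.div_const σ
  exact le_of_tendsto_of_tendsto' hQ hbd (fun n => (hx _ (hεpos n)).2.2)

lemma Qone_monotone_right {a c μ σ v : ℝ} (hμ : μ < 0) (hσ : σ < 0) (hv : 0 ≤ a + c * v) :
    Monotone (Qone a c μ σ v) := by
  intro x y hxy
  have hE : Real.exp (μ * (a + c * v)) ≤ 1 :=
    Real.exp_le_one_iff.2 (mul_nonpos_of_nonpos_of_nonneg hμ.le hv)
  have h : 0 ≤ (σ / μ) * (1 - Real.exp (μ * (a + c * v))) :=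
    mul_nonneg (div_pos_of_neg_of_neg hσ hμ).le (by linarith)
  simp only [Qone]
  nlinarith [mul_le_mul_of_nonneg_left hxy h]

/-- If the only zero pair of the system `Q₁(N', M) = 0 = Q₁(M, N')` in the box is trivial, then the
only pair satisfying the corresponding inequalities is trivial. -/
lemma eq_zero_of_Qone_ineq {a c μ σ L S : ℝ} (ha : 0 < a) (hc : 0 < c) (hσ : σ < 0) (hμ : μ < 0)
    (huniq : ∀ M N' : ℝ, M ∈ Icc (Mzero a c) (0:ℝ) → N' ∈ Icc (0:ℝ) (Nzero a c μ σ) →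
      Qone a c μ σ N' M = 0 → Qone a c μ σ M N' = 0 → M = 0 ∧ N' = 0)
    (hL : L ∈ Icc (Mzero a c) (0:ℝ)) (hS : S ∈ Icc (0:ℝ) (Nzero a c μ σ))
    (h1 : Qone a c μ σ S L ≤ 0) (h2 : 0 ≤ Qone a c μ σ L S) : L = 0 ∧ S = 0 := by
  have hcM : a + c * Mzero a c = 0 := by
    simp only [Mzero]
    field_simp
    ring
  have hρ : 0 < μ / σ := div_pos_of_neg_of_neg hμ hσ
  have hM0 : Mzero a c < 0 := div_neg_of_neg_of_pos (by linarith) hc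
  have hN0 : 0 < Nzero a c μ σ :=
    div_pos_of_neg_of_neg (mul_neg_of_pos_of_neg ha hσ) (mul_neg_of_pos_of_neg hc hμ)
  have hMN : σ / μ * Mzero a c = -Nzero a c μ σ := by
    simp only [Mzero, Nzero]
    field_simp
  have hdel : ∀ v, Mzero a c ≤ v → 0 ≤ a + c * v := fun v hv => by
    have := mul_le_mul_of_nonneg_left hv hc.le
    linarith
  have hQM : ∀ x, Qone a c μ σ (Mzero a c) x < 0 := fun x => by
    simp only [Qone, hcM, mul_zero, Real.exp_zero]
    nlinarith
  have hQN : ∀ x, Mzero a c ≤ x → 0 < Qone a c μ σ (Nzero a c μ σ) x := fun x hx => by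
    refine lt_of_lt_of_le ?_ (Qone_monotone_right hμ hσ (hdel _ (hM0.trans hN0).le) hx)
    simp only [Qone, hMN]
    have hE := Real.exp_pos (μ * (a + c * Nzero a c μ σ))
    have e1 := mul_pos hN0 hE
    have e2 := mul_pos hρ e1
    nlinarith
  have hcont1 : Continuous fun p : ℝ × ℝ => Qone a c μ σ p.2 p.1 :=
    (continuous_Qone a c μ σ).comp continuous_swap
  have hcont2 := continuous_Qone a c μ σ
  let C : Set (ℝ × ℝ) := (Icc (Mzero a c) L ×ˢ Icc S (Nzero a c μ σ)) ∩
    ({p | Qone a c μ σ p.2 p.1 ≤ 0} ∩ {p | 0 ≤ Qone a c μ σ p.1 p.2})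
  have hC : IsCompact C := (isCompact_Icc.prod isCompact_Icc).inter_right
    ((isClosed_le hcont1 continuous_const).inter (isClosed_le continuous_const hcont2))
  have hCne : C.Nonempty := ⟨(L, S), ⟨⟨⟨hL.1, le_rfl⟩, ⟨le_rfl, hS.2⟩⟩, h1, h2⟩⟩
  obtain ⟨⟨M, N⟩, ⟨⟨hMm, hNm⟩, hq1, hq2⟩, hmax⟩ :=
    hC.exists_isMaxOn hCne (f := fun p : ℝ × ℝ => p.2 - p.1) (by fun_prop)
  simp only [mem_ofPred_eq, mem_Icc] at hMm hNm hq1 hq2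
  have hzero1 : Qone a c μ σ N M = 0 := by
    by_contra hne
    have hlt : Qone a c μ σ N M < 0 := lt_of_le_of_ne hq1 hne
    have hcN : Continuous fun s => Qone a c μ σ s M :=
      hcont2.comp (Continuous.prodMk continuous_id continuous_const)
    obtain ⟨s, hs, hs0⟩ := intermediate_value_Icc hNm.2 hcN.continuousOn
      ⟨hlt.le, (hQN M hMm.1).le⟩
    have hsN : N < s := lt_of_le_of_ne hs.1 fun h => by
      subst h
      exact hne hs0
    have hmem : (M, s) ∈ C := ⟨⟨hMm, ⟨hNm.1.trans hs.1, hs.2⟩⟩, hs0.le,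
      hq2.trans (Qone_monotone_right hμ hσ (hdel M hMm.1) hs.1)⟩
    have := hmax hmem
    simp only [mem_ofPred_eq] at this
    linarith
  have hzero2 : Qone a c μ σ M N = 0 := by
    by_contra hne
    have hlt : 0 < Qone a c μ σ M N := lt_of_le_of_ne hq2 (Ne.symm hne)
    have hcM' : Continuous fun s => Qone a c μ σ s N :=
      hcont2.comp (Continuous.prodMk continuous_id continuous_const)
    obtain ⟨s, hs, hs0⟩ := intermediate_value_Icc hMm.1 hcM'.continuousOn
      ⟨(hQM N).le, hlt.le⟩
    have hsM : s < M := lt_of_le_of_ne hs.2 fun h => by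
      subst h
      exact hne hs0
    have hmem : (s, N) ∈ C := ⟨⟨⟨hs.1, hs.2.trans hMm.2⟩, hNm⟩,
      (Qone_monotone_right hμ hσ (hdel N (by linarith [hS.1, hNm.1])) hs.2).trans hq1, hs0.ge⟩
    have := hmax hmem
    simp only [mem_ofPred_eq] at this
    linarith
  obtain ⟨hM, hN⟩ := huniq M N ⟨hMm.1, hMm.2.trans hL.2⟩ ⟨hS.1.trans hNm.1, hNm.2⟩ hzero1 hzero2
  exact ⟨le_antisymm hL.2 (hM ▸ hMm.2), le_antisymm (hN ▸ hNm.1) hS.1⟩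

/-- A solution has the expected right derivative at every time `t ≥ 0`. -/
lemma IsSDDESolution.hasDerivWithinAt_Ici {a c μ σ : ℝ} {φ u : ℝ → ℝ}
    (hu : IsSDDESolution a c μ σ φ u) {t : ℝ} (ht : 0 ≤ t) :
    HasDerivWithinAt u (μ * u t + σ * u (t - a - c * u t)) (Ici t) t := by
  obtain ⟨hcont, -, -, hd⟩ := hu
  rcases ht.eq_or_lt with rfl | ht
  · refine hasDerivWithinAt_Ici_of_tendsto_deriv (s := Ioi 0)
      (fun s hs => (hd s hs).differentiableAt.differentiableWithinAt)
      hcont.continuousWithinAt self_mem_nhdsWithin ?_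
    have hF : Continuous fun t => μ * u t + σ * u (t - a - c * u t) := by fun_prop
    refine (hF.continuousWithinAt (s := Ioi 0) (x := 0)).tendsto.congr' ?_
    filter_upwards [self_mem_nhdsWithin] with s hs
    exact (hd s hs).deriv.symm
  · exact (hd t ht).hasDerivWithinAt

lemma IsSDDESolution.Mzero_le {a c μ σ : ℝ} {φ u : ℝ → ℝ} (ha : 0 < a) (hc : 0 < c)
    (hσ : σ < 0) (hμ : μ < 0) (hu : IsSDDESolution a c μ σ φ u) (h0 : Mzero a c ≤ u 0)
    {t : ℝ} (ht : 0 ≤ t) : Mzero a c ≤ u t := by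
  have hM0 : Mzero a c < 0 := div_neg_of_neg_of_pos (by linarith) hc
  refine neg_le_neg_iff.1 (image_le_of_deriv_right_lt_deriv_boundary (f := fun s => -u s)
    (f' := fun s => -(μ * u s + σ * u (s - a - c * u s))) (a := 0) (b := t)
    (B := fun _ => -Mzero a c) (B' := fun _ => 0) hu.1.neg.continuousOn
    (fun s hs => (hu.hasDerivWithinAt_Ici hs.1).neg) (neg_le_neg h0)
    (fun s => hasDerivAt_const s _) ?_ ⟨ht, le_rfl⟩)
  intro s hs h
  have hs' : u s = Mzero a c := neg_injective h
  have : s - a - c * Mzero a c = s := by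
    simp only [Mzero]
    field_simp
    ring
  simp only [hs', this]
  nlinarith

lemma IsSDDESolution.le_of_history_ge {a c μ σ N : ℝ} {φ u : ℝ → ℝ} (ha : 0 < a) (hc : 0 < c)
    (hσ : σ < 0) (hμ : μ < 0) (hu : IsSDDESolution a c μ σ φ u) (h0 : u 0 ≤ N)
    (hN : Nzero a c μ σ ≤ N) (hlow : ∀ s ≥ -(a + c * N), Mzero a c ≤ u s)
    {t : ℝ} (ht : 0 ≤ t) : u t ≤ N := by
  have hN0 : 0 < Nzero a c μ σ :=
    div_pos_of_neg_of_neg (mul_neg_of_pos_of_neg ha hσ) (mul_neg_of_pos_of_neg hc hμ)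
  have hMN : σ * Mzero a c = -(μ * Nzero a c μ σ) := by
    have hμ0 := hμ.ne
    simp only [Mzero, Nzero]
    field_simp
  have hε : ∀ ε > 0, c * ε ≤ 1 → u t ≤ N + ε * t := by
    intro ε hε hcε
    refine image_le_of_deriv_right_lt_deriv_boundary (f := u)
      (f' := fun s => μ * u s + σ * u (s - a - c * u s)) (a := 0) (b := t)
      (B := fun s => N + ε * s) (B' := fun _ => ε) hu.1.continuousOn
      (fun s hs => hu.hasDerivWithinAt_Ici hs.1) (by simpa using h0)
      (fun s => by simpa using ((hasDerivAt_id s).const_mul ε).const_add N) ?_ ⟨ht, le_rfl⟩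
    intro s hs h
    have hs0 : 0 ≤ s := hs.1
    have hge : s - a - c * u s ≥ -(a + c * N) := by
      rw [h]
      nlinarith
    have h1 := mul_le_mul_of_nonpos_left (hlow _ hge) hσ.le
    have h2 : Nzero a c μ σ ≤ u s := by
      rw [h]
      nlinarith
    have h3 := mul_le_mul_of_nonpos_left h2 hμ.le
    linarith
  have hlim : Tendsto (fun ε => N + ε * t) (nhdsWithin 0 (Ioi 0)) (nhds N) := by
    have : Continuous fun ε : ℝ => N + ε * t := by fun_prop
    simpa using (this.tendsto 0).mono_left nhdsWithin_le_nhds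
  refine ge_of_tendsto hlim ?_
  filter_upwards [Ioo_mem_nhdsGT (show (0:ℝ) < 1 / c by positivity)] with ε hεm
  refine hε ε hεm.1 ?_
  have := (lt_div_iff₀ hc).1 hεm.2
  linarith

/-- Global asymptotic stability criterion, first-order version. -/
theorem sdde_gas_criterion_Q1
    (a c μ σ N τ : ℝ) (φ : ℝ → ℝ)
    (ha : 0 < a) (hc : 0 < c) (hσμ : σ ≤ μ) (hμ : μ < 0)
    (hN : N = max (Nzero a c μ σ) (φ 0)) (hτ : τ = a + c * N)
    (hφcont : Continuous φ)
    (hφ : ∀ t ∈ Set.Icc (-τ) (0:ℝ), Mzero a c ≤ φ t)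
    (huniq : ∀ M N' : ℝ, M ∈ Set.Icc (Mzero a c) (0:ℝ) →
      N' ∈ Set.Icc (0:ℝ) (Nzero a c μ σ) →
      Qone a c μ σ N' M = 0 → Qone a c μ σ M N' = 0 → M = 0 ∧ N' = 0) :
    ∀ u : ℝ → ℝ, IsSDDESolution a c μ σ φ u →
      Filter.Tendsto u Filter.atTop (nhds 0) := by
  intro u hu
  have hσ : σ < 0 := hσμ.trans_lt hμ
  have hM0 : Mzero a c < 0 := div_neg_of_neg_of_pos (by linarith) hc
  have hN0 : 0 < Nzero a c μ σ :=
    div_pos_of_neg_of_neg (mul_neg_of_pos_of_neg ha hσ) (mul_neg_of_pos_of_neg hc hμ)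
  have hMN : σ / μ * Mzero a c = -Nzero a c μ σ := by
    simp only [Mzero, Nzero]
    field_simp
  have hNN : Nzero a c μ σ ≤ N := hN ▸ le_max_left _ _
  have hτ0 : 0 ≤ τ := by
    have := mul_pos hc (hN0.trans_le hNN)
    linarith
  have hu0 : u 0 = φ 0 := hu.2.1 0 le_rfl
  have hlow0 : ∀ t ≥ 0, Mzero a c ≤ u t := fun t ht =>
    hu.Mzero_le ha hc hσ hμ (hu0 ▸ hφ 0 ⟨by linarith, le_rfl⟩) ht
  have hlow : ∀ t ≥ -(a + c * N), Mzero a c ≤ u t := fun t ht => by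
    rcases le_total t 0 with h | h
    · exact hu.2.1 t h ▸ hφ t ⟨hτ ▸ ht, h⟩
    · exact hlow0 t h
  have hup : ∀ t ≥ 0, u t ≤ N := fun t ht =>
    hu.le_of_history_ge ha hc hσ hμ (hu0 ▸ hN ▸ le_max_right _ _) hNN hlow ht
  have hcM : a + c * Mzero a c = 0 := by
    simp only [Mzero]
    field_simp
    ring
  have hdel : ∀ v, Mzero a c ≤ v → 0 ≤ a + c * v := fun v hv => by
    have := mul_le_mul_of_nonneg_left hv hc.le
    linarith
  have hK : ∀ t ≥ 0, |u t| ≤ max N (-Mzero a c) := fun t ht =>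
    abs_le.2 ⟨by linarith [hlow0 t ht, le_max_right N (-Mzero a c)],
      (hup t ht).trans (le_max_left _ _)⟩
  have hbdA : IsBoundedUnder (· ≤ ·) atTop u :=
    isBoundedUnder_of_eventually_le ((eventually_ge_atTop 0).mono hup)
  have hbdB : IsBoundedUnder (· ≥ ·) atTop u :=
    isBoundedUnder_of_eventually_ge ((eventually_ge_atTop 0).mono hlow0)
  set S := limsup u atTop with hSdef
  set L := liminf u atTop with hLdef
  have hLS : L ≤ S := liminf_le_limsup hbdA hbdB
  have hML : Mzero a c ≤ L :=
    le_liminf_of_le hbdA.isCoboundedUnder_ge ((eventually_ge_atTop 0).mono hlow0)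
  have hSup : ∀ ε > 0, ∀ᶠ t in atTop, u t < S + ε := fun ε hε =>
    eventually_lt_of_limsup_lt (by linarith) hbdA
  have hLlow : ∀ ε > 0, ∀ᶠ t in atTop, L - ε < u t := fun ε hε =>
    eventually_lt_of_lt_liminf (by linarith) hbdB
  have hSfreq : ∀ ε > 0, ∃ᶠ t in atTop, S - ε < u t := fun ε hε =>
    frequently_lt_of_lt_limsup hbdB.isCoboundedUnder_le (by linarith)
  have hLfreq : ∀ ε > 0, ∃ᶠ t in atTop, u t < L + ε := fun ε hε =>
    frequently_lt_of_liminf_lt hbdA.isCoboundedUnder_ge (by linarith)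
  have hQ1 : Qone a c μ σ S L ≤ 0 :=
    Qone_upper_lower_nonpos hμ hσ hu.2.2.2 hK (fun t ht => hdel _ (hlow0 t ht)) hSfreq hSup hLlow
  have hQ2 : 0 ≤ Qone a c μ σ L S := by
    have h := Qone_upper_lower_nonpos (a := a) (c := -c) (u := fun t => -u t) (S := -L) (L := -S)
      hμ hσ
      (fun t ht => by
        refine (hu.2.2.2 t ht).fun_neg.congr_deriv ?_
        simp only [neg_mul_neg]
        ring)
      (fun t ht => (abs_neg (u t)).trans_le (hK t ht))
      (fun t ht => by simpa using hdel _ (hlow0 t ht))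
      (fun ε hε => (hLfreq ε hε).mono fun t ht => by linarith)
      (fun ε hε => (hLlow ε hε).mono fun t ht => by linarith)
      (fun ε hε => (hSup ε hε).mono fun t ht => by linarith)
    rw [Qone_neg] at h
    linarith
  have hρ : 0 < μ / σ := div_pos_of_neg_of_neg hμ hσ
  have hρ' : 0 < σ / μ := div_pos_of_neg_of_neg hσ hμ
  have hE : ∀ v, Mzero a c ≤ v → Real.exp (μ * (a + c * v)) ≤ 1 := fun v hv =>
    Real.exp_le_one_iff.2 (mul_nonpos_of_nonpos_of_nonneg hμ.le (hdel v hv))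
  have hpos : ∀ v, 1 ≤ 1 + μ / σ * Real.exp (μ * (a + c * v)) := fun v =>
    le_add_of_nonneg_right (mul_pos hρ (Real.exp_pos _)).le
  have hL0 : L ≤ 0 := by
    by_contra! h
    have h1 : 0 ≤ σ / μ * L * (1 - Real.exp (μ * (a + c * S))) :=
      mul_nonneg (mul_pos hρ' h).le (sub_nonneg.2 (hE S (hML.trans hLS)))
    have h2 := mul_pos (one_pos.trans_le (hpos S)) (h.trans_le hLS)
    simp only [Qone] at hQ1
    linarith
  have hS0 : 0 ≤ S := by
    by_contra! h
    have h1 : σ / μ * S * (1 - Real.exp (μ * (a + c * L))) ≤ 0 :=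
      mul_nonpos_of_nonpos_of_nonneg (mul_neg_of_pos_of_neg hρ' h).le (sub_nonneg.2 (hE L hML))
    have h2 := mul_neg_of_pos_of_neg (one_pos.trans_le (hpos L)) (hLS.trans_lt h)
    simp only [Qone] at hQ2
    linarith
  have hSN : S ≤ Nzero a c μ σ := by
    have h1 := (Qone_monotone_right hμ hσ (hdel S (hML.trans hLS)) hML).trans hQ1
    simp only [Qone, hMN] at h1
    have h2 := le_mul_of_one_le_left hS0 (hpos S)
    have h3 := mul_pos hN0 (Real.exp_pos (μ * (a + c * S)))
    linarith
  obtain ⟨hLz, hSz⟩ := eq_zero_of_Qone_ineq ha hc hσ hμ huniq ⟨hML, hL0⟩ ⟨hS0, hSN⟩ hQ1 hQ2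
  exact tendsto_of_liminf_eq_limsup hLz hSz hbdA hbdB
end
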